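/- arXiv:2010.09428 — 2 statements merged into one kernel-verified Lean document; each statement's English description precedes it below -/
import Mathlib

section
/- Let p ∈ ℂ[z₁,…,zₙ] and define μ : ℂⁿ → ℂⁿ × ℂ by μ(z) = (z, p(z)). Let Y ⊆ ℂⁿ be a compact polynomial polyhedron, let V = {(z,w) ∈ Y × ℂ : |w| ≤ 1}, and let X = {z ∈ Y : |p(z)| ≤ 1}. Then for every function f holomorphic on an open neighborhood of X there exist a function h holomorphic on an open neighborhood of V and an open neighborhood of X on which f(z) = h(μ(z)). -/
/-- A compact set `L ⊆ ℂⁿ` is a compact polynomial polyhedron if there are polynomials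
`p₁, …, p_k` with `L = {z : |p₁ z| ≤ 1, …, |p_k z| ≤ 1}`. -/
def IsPolyPolyhedron {n : ℕ} (L : Set (Fin n → ℂ)) : Prop :=
  IsCompact L ∧ ∃ (k : ℕ) (p : Fin k → MvPolynomial (Fin n) ℂ),
    L = {z | ∀ j, ‖MvPolynomial.eval z (p j)‖ ≤ 1}

open Set Filter Topology Metric

/-- Cauchy estimate for the Fréchet derivative. -/
lemma oka_cauchy_est {E : Type*} [NormedAddCommGroup E] [NormedSpace ℂ E] (f : E → ℂ) (x : E)
    (r C : ℝ) (hr : 0 < r) (hd : ∀ y ∈ closedBall x r, DifferentiableAt ℂ f y)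
    (hC : ∀ y ∈ closedBall x r, ‖f y‖ ≤ C) : ‖fderiv ℂ f x‖ ≤ C / r := by
  have hC0 : 0 ≤ C := (norm_nonneg _).trans (hC x (mem_closedBall_self hr.le))
  refine ContinuousLinearMap.opNorm_le_bound _ (by positivity) fun v => ?_
  rcases eq_or_ne v 0 with rfl | hv
  · simp
  have hv' : 0 < ‖v‖ := norm_pos_iff.2 hv
  have hmem : ∀ t ∈ closedBall (0:ℂ) (r / ‖v‖), x + t • v ∈ closedBall x r := by
    intro t ht
    rw [mem_closedBall_zero_iff, le_div_iff₀ hv'] at ht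
    simpa [mem_closedBall, dist_eq_norm, norm_smul] using ht
  have hline : ∀ t : ℂ, HasDerivAt (fun t : ℂ => x + t • v) v t := by
    intro t
    simpa using ((hasDerivAt_id t).smul_const v).const_add x
  have hdt : ∀ t ∈ closedBall (0:ℂ) (r / ‖v‖),
      HasDerivAt (fun t : ℂ => f (x + t • v)) (fderiv ℂ f (x + t • v) v) t := by
    intro t ht
    exact (hd _ (hmem t ht)).hasFDerivAt.comp_hasDerivAt t (hline t)
  have h0 := hdt 0 (mem_closedBall_self (by positivity))
  have := Complex.norm_deriv_le_of_forall_mem_sphere_norm_le (c := (0:ℂ)) (R := r / ‖v‖) (C := C)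
    (f := fun t : ℂ => f (x + t • v)) (by positivity) ?_ ?_
  · rw [h0.deriv] at this
    simp only [zero_smul, add_zero] at this
    refine this.trans (le_of_eq ?_)
    field_simp
  · refine DifferentiableOn.diffContOnCl fun t ht => ?_
    exact (hdt t (closure_ball_subset_closedBall ht)).differentiableAt.differentiableWithinAt
  · intro t ht
    exact hC _ (hmem t (sphere_subset_closedBall ht))

/-- Holomorphic dependence of an integral on parameters, at one point. -/
lemma oka_param_at {E : Type*} [NormedAddCommGroup E] [NormedSpace ℂ E] [ProperSpace E]
    (G : E × ℝ → ℂ) (a b : ℝ) (x0 : E)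
    (h : ∀ t ∈ uIcc a b, ∀ᶠ y in 𝓝 (x0, t),
      DifferentiableAt ℂ (fun x => G (x, y.2)) y.1 ∧ ContinuousAt G y) :
    DifferentiableAt ℂ (fun x => ∫ t in a..b, G (x, t)) x0 := by
  have hcomp : IsCompact (uIcc a b) := isCompact_uIcc
  have hc0 : ContinuousOn (fun t => G (x0, t)) (uIcc a b) := by
    intro t ht
    have h1 : ContinuousAt G (x0, t) := (h t ht).self_of_nhds.2
    exact (ContinuousAt.comp (f := fun t : ℝ => (x0, t)) h1
      (by fun_prop)).continuousWithinAt
  obtain ⟨M, hM⟩ := hcomp.exists_bound_of_continuousOn hc0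
  have h2 : ∀ t ∈ uIcc a b, ∀ᶠ y in 𝓝 (x0, t),
      DifferentiableAt ℂ (fun x => G (x, y.2)) y.1 ∧ ContinuousAt G y ∧ ‖G y‖ ≤ M + 1 := by
    intro t ht
    have h1 : ContinuousAt G (x0, t) := (h t ht).self_of_nhds.2
    have h3 : ∀ᶠ y in 𝓝 (x0, t), ‖G y‖ < M + 1 :=
      h1.norm.eventually (gt_mem_nhds (lt_of_le_of_lt (hM t ht) (by linarith)))
    filter_upwards [h t ht, h3] with y hy hy3 using ⟨hy.1, hy.2, hy3.le⟩
  have h3 := hcomp.eventually_forall_of_forall_eventually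
    (P := fun (x : E) (t : ℝ) => DifferentiableAt ℂ (fun x => G (x, t)) x ∧
      ContinuousAt G (x, t) ∧ ‖G (x, t)‖ ≤ M + 1) h2
  obtain ⟨r, hr, hball⟩ := Metric.eventually_nhds_iff_ball.1 h3
  have hr4 : 0 < r / 4 := by positivity
  have key : ∀ x ∈ ball x0 (r / 4), ∀ t ∈ uIcc a b,
      ‖fderiv ℂ (fun x => G (x, t)) x‖ ≤ (M + 1) / (r / 4) := by
    intro x hx t ht
    have hs : ∀ y ∈ closedBall x (r / 4), y ∈ ball x0 r := by
      intro y hy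
      rw [mem_ball] at *
      rw [mem_closedBall] at hy
      linarith [dist_triangle y x x0]
    exact oka_cauchy_est _ x _ _ hr4 (fun y hy => (hball y (hs y hy) t ht).1)
      (fun y hy => (hball y (hs y hy) t ht).2.2)
  have hFc : ContinuousOn (fun t => fderiv ℂ (fun x => G (x, t)) x0) (uIcc a b) := by
    intro t1 ht1
    rw [ContinuousWithinAt, Metric.tendsto_nhds]
    intro η hη
    have hs : ∀ y ∈ closedBall x0 (r / 4), y ∈ ball x0 r := by
      intro y hy
      rw [mem_closedBall] at hy
      rw [mem_ball]
      linarith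
    have hcl : IsCompact (closedBall x0 (r / 4)) := isCompact_closedBall _ _
    have h5 : ∀ᶠ s in 𝓝 t1, ∀ x ∈ closedBall x0 (r / 4),
        ‖G (x, s) - G (x, t1)‖ ≤ η / 2 * (r / 4) := by
      refine hcl.eventually_forall_of_forall_eventually
        (P := fun s x => ‖G (x, s) - G (x, t1)‖ ≤ η / 2 * (r / 4)) ?_
      intro x hx
      have hcx : ContinuousAt G (x, t1) := (hball x (hs x hx) t1 ht1).2.1
      have hA : ContinuousAt (fun z : ℝ × E => ‖G (z.2, z.1) - G (z.2, t1)‖) (t1, x) := by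
        refine (ContinuousAt.sub ?_ ?_).norm
        · exact ContinuousAt.comp (f := fun z : ℝ × E => (z.2, z.1)) hcx (by fun_prop)
        · exact ContinuousAt.comp (f := fun z : ℝ × E => (z.2, t1)) hcx (by fun_prop)
      have : ∀ᶠ z in 𝓝 (t1, x), ‖G (z.2, z.1) - G (z.2, t1)‖ < η / 2 * (r / 4) :=
        hA.eventually (gt_mem_nhds (by simp; positivity))
      exact this.mono fun z hz => hz.le
    filter_upwards [nhdsWithin_le_nhds h5, self_mem_nhdsWithin] with s hs5 hsK
    have hx0 : x0 ∈ closedBall x0 (r / 4) := mem_closedBall_self hr4.le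
    have hsub : fderiv ℂ (fun x => G (x, s)) x0 - fderiv ℂ (fun x => G (x, t1)) x0
        = fderiv ℂ (fun x => G (x, s) - G (x, t1)) x0 := by
      rw [← fderiv_sub (hball x0 (hs _ hx0) s hsK).1 (hball x0 (hs _ hx0) t1 ht1).1]
      rfl
    rw [dist_eq_norm, hsub]
    have := oka_cauchy_est (fun x => G (x, s) - G (x, t1)) x0 (r / 4) _ hr4
      (fun y hy => (hball y (hs _ hy) s hsK).1.sub (hball y (hs _ hy) t1 ht1).1) hs5
    refine this.trans_lt ?_
    rw [mul_div_assoc, div_self hr4.ne']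
    linarith
  have hcx : ∀ x ∈ ball x0 r, ContinuousOn (fun t => G (x, t)) (uIcc a b) := by
    intro x hx t ht
    exact (ContinuousAt.comp (f := fun t : ℝ => (x, t)) (hball x hx t ht).2.1
      (by fun_prop)).continuousWithinAt
  have hmain := intervalIntegral.hasFDerivAt_integral_of_dominated_of_fderiv_le
    (𝕜 := ℂ) (μ := MeasureTheory.volume) (F := fun x t => G (x, t)) (x₀ := x0) (a := a) (b := b)
    (s := ball x0 (r / 4))
    (F' := fun x t => fderiv ℂ (fun x => G (x, t)) x) (bound := fun _ => (M + 1) / (r / 4))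
    (ball_mem_nhds _ hr4) ?_ ?_ ?_ ?_ ?_ ?_
  · exact hmain.differentiableAt
  · filter_upwards [ball_mem_nhds x0 hr] with x hx
    exact ((hcx x hx).mono uIoc_subset_uIcc).aestronglyMeasurable measurableSet_uIoc
  · exact (hcx x0 (mem_ball_self hr)).intervalIntegrable
  · exact (hFc.mono uIoc_subset_uIcc).aestronglyMeasurable measurableSet_uIoc
  · exact Eventually.of_forall fun t ht x hx => key x hx t (uIoc_subset_uIcc ht)
  · exact intervalIntegrable_const
  · refine Eventually.of_forall fun t ht x hx => ?_
    exact (hball x (ball_subset_ball (by linarith) hx) t (uIoc_subset_uIcc ht)).1.hasFDerivAt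

/-- Holomorphic dependence of an integral on parameters. -/
lemma oka_param {E : Type*} [NormedAddCommGroup E] [NormedSpace ℂ E] [ProperSpace E]
    (G : E × ℝ → ℂ) (a b : ℝ) (x0 : E)
    (h : ∀ t ∈ uIcc a b, ∀ᶠ y in 𝓝 (x0, t),
      DifferentiableAt ℂ (fun x => G (x, y.2)) y.1 ∧ ContinuousAt G y) :
    ∀ᶠ x in 𝓝 x0, DifferentiableAt ℂ (fun x => ∫ t in a..b, G (x, t)) x := by
  have h1 := isCompact_uIcc.eventually_forall_of_forall_eventually
    (P := fun (x : E) (t : ℝ) => ∀ᶠ y in 𝓝 (x, t),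
      DifferentiableAt ℂ (fun x => G (x, y.2)) y.1 ∧ ContinuousAt G y)
    (fun t ht => eventually_eventually_nhds.2 (h t ht))
  exact h1.mono fun x hx => oka_param_at G a b x hx

/-- Version for a jointly holomorphic integrand along a curve. -/
lemma oka_param_curve {E : Type*} [NormedAddCommGroup E] [NormedSpace ℂ E] [ProperSpace E]
    (Φ : E × ℂ → ℂ) (γ κ : ℝ → ℂ) (hγ : Continuous γ) (hκ : Continuous κ) (a b : ℝ) (x0 : E)
    (h : ∀ t ∈ uIcc a b, ∀ᶠ y in 𝓝 (x0, γ t), DifferentiableAt ℂ Φ y) :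
    ∀ᶠ x in 𝓝 x0, DifferentiableAt ℂ (fun x => ∫ t in a..b, κ t * Φ (x, γ t)) x := by
  refine oka_param (fun y => κ y.2 * Φ (y.1, γ y.2)) a b x0 fun t ht => ?_
  have hc : ContinuousAt (fun y : E × ℝ => (y.1, γ y.2)) (x0, t) := by fun_prop
  filter_upwards [hc.eventually (h t ht)] with y hy
  constructor
  · refine DifferentiableAt.const_mul ?_ _
    exact DifferentiableAt.comp (f := fun x => (x, γ y.2)) y.1 hy (by fun_prop)
  · refine ContinuousAt.mul (by fun_prop) ?_
    exact ContinuousAt.comp (f := fun y : E × ℝ => (y.1, γ y.2)) hy.continuousAt (by fun_prop)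

lemma oka_ftc_log (u v : ℂ) (s : ℂ) (a b : ℝ)
    (h : ∀ t ∈ uIcc a b, s * (u + t * v) ∈ Complex.slitPlane) :
    v * ∫ t in a..b, (u + t * v)⁻¹ = Complex.log (s * (u + b * v)) - Complex.log (s * (u + a * v)) := by
  have h0 : ∀ t ∈ uIcc a b, u + t * v ≠ 0 := by
    intro t ht h0
    have := h t ht
    rw [h0] at this
    simp at this
  rw [← intervalIntegral.integral_const_mul]
  refine intervalIntegral.integral_eq_sub_of_hasDerivAt
    (f := fun t : ℝ => Complex.log (s * (u + t * v))) ?_ ?_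
  · intro t ht
    have h1 : HasDerivAt (fun t : ℝ => s * (u + t * v)) (s * v) t := by
      have := (((hasDerivAt_id t).ofReal_comp).mul_const v).const_add u |>.const_mul s
      simpa using this
    have h2 := h1.clog_real (h t ht)
    have hs : s ≠ 0 := by
      rintro rfl
      have := h t ht
      simp at this
    rw [mul_div_mul_left _ _ hs, div_eq_mul_inv] at h2
    exact h2
  · refine ContinuousOn.intervalIntegrable ?_
    refine ContinuousOn.mul continuousOn_const (ContinuousOn.inv₀ (by fun_prop) h0)

/-- The boundary integral over a rectangle. -/
noncomputable def okaRect (x1 x2 y1 y2 : ℝ) (f : ℂ → ℂ) : ℂ :=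
  (∫ x : ℝ in x1..x2, f (x + y1 * Complex.I)) - (∫ x : ℝ in x1..x2, f (x + y2 * Complex.I)) +
      Complex.I * (∫ y : ℝ in y1..y2, f (x2 + y * Complex.I)) -
      Complex.I * (∫ y : ℝ in y1..y2, f (x1 + y * Complex.I))

lemma oka_winding (x1 x2 y1 y2 : ℝ) (z : ℂ) (hx1 : x1 < z.re) (hx2 : z.re < x2) (hy1 : y1 < z.im)
    (hy2 : z.im < y2) : okaRect x1 x2 y1 y2 (fun ζ => (ζ - z)⁻¹) = 2 * Real.pi * Complex.I := by
  have hb := oka_ftc_log (y1 * Complex.I - z) 1 1 x1 x2 (by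
    intro t ht
    right
    simp; intro hh; linarith)
  have ht := oka_ftc_log (y2 * Complex.I - z) 1 1 x1 x2 (by
    intro t ht
    right
    simp; intro hh; linarith)
  have hr := oka_ftc_log (x2 - z) Complex.I 1 y1 y2 (by
    intro t ht
    left
    simp; linarith)
  have hl := oka_ftc_log (x1 - z) Complex.I (-1) y1 y2 (by
    intro t ht
    left
    simp; linarith)
  have e1 : ∀ (x : ℝ) (w : ℂ), (x : ℂ) + w - z = w - z + x * 1 := by intros; ring
  have e2 : ∀ (x y : ℝ), (x : ℂ) + y * Complex.I - z = x - z + y * Complex.I := by intros; ring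
  unfold okaRect
  rw [show (∫ y : ℝ in y1..y2, ((x2:ℂ) + y * Complex.I - z)⁻¹)
      = ∫ y : ℝ in y1..y2, ((x2:ℂ) - z + y * Complex.I)⁻¹ by simp only [e2], hr,
    show (∫ y : ℝ in y1..y2, ((x1:ℂ) + y * Complex.I - z)⁻¹)
      = ∫ y : ℝ in y1..y2, ((x1:ℂ) - z + y * Complex.I)⁻¹ by simp only [e2], hl]
  simp only [e1]
  rw [one_mul] at hb ht
  rw [hb, ht]
  have c1 : Complex.log ((y2 * Complex.I - z) + x1 * 1) - Complex.log (-((y2 * Complex.I - z) + x1 * 1))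
      = Real.pi * Complex.I := by
    rw [Complex.log, Complex.log, Complex.arg_neg_eq_arg_sub_pi_of_im_pos (by simp; linarith), norm_neg]
    push_cast
    ring
  have c2 : Complex.log (-((y1 * Complex.I - z) + x1 * 1)) - Complex.log ((y1 * Complex.I - z) + x1 * 1)
      = Real.pi * Complex.I := by
    rw [Complex.log, Complex.log, Complex.arg_neg_eq_arg_add_pi_of_im_neg (by simp; linarith), norm_neg]
    push_cast
    ring
  have d1 : (-1 : ℂ) * (x1 - z + y1 * Complex.I) = -((y1 * Complex.I - z) + x1 * 1) := by ring
  have d2 : (-1 : ℂ) * (x1 - z + y2 * Complex.I) = -((y2 * Complex.I - z) + x1 * 1) := by ring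
  have d3 : (1 : ℂ) * (x2 - z + y1 * Complex.I) = 1 * ((y1 * Complex.I - z) + x2 * 1) := by ring
  have d4 : (1 : ℂ) * (x2 - z + y2 * Complex.I) = 1 * ((y2 * Complex.I - z) + x2 * 1) := by ring
  rw [d1, d2, d3, d4]
  simp only [one_mul]
  linear_combination c1 + c2

lemma oka_rect_cauchy (x1 x2 y1 y2 : ℝ) (z : ℂ) (f : ℂ → ℂ) (hx1 : x1 < z.re) (hx2 : z.re < x2)
    (hy1 : y1 < z.im) (hy2 : z.im < y2)
    (hf : ∀ ζ : ℂ, ζ.re ∈ Icc x1 x2 → ζ.im ∈ Icc y1 y2 → DifferentiableAt ℂ f ζ) :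
    okaRect x1 x2 y1 y2 (fun ζ => f ζ * (ζ - z)⁻¹) = 2 * Real.pi * Complex.I * f z := by
  have hx := hx1.trans hx2
  have hy := hy1.trans hy2
  have hfz := hf z ⟨hx1.le, hx2.le⟩ ⟨hy1.le, hy2.le⟩
  have hcd : ∀ ζ : ℂ, ζ.re ∈ Icc x1 x2 → ζ.im ∈ Icc y1 y2 → ContinuousAt (dslope f z) ζ := by
    intro ζ h1 h2
    rcases eq_or_ne ζ z with rfl | hne
    · exact continuousAt_dslope_same.2 hfz
    · exact (continuousAt_dslope_of_ne hne).2 (hf ζ h1 h2).continuousAt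
  have h0 : okaRect x1 x2 y1 y2 (dslope f z) = 0 := by
    have := Complex.integral_boundary_rect_eq_zero_of_differentiable_on_off_countable (dslope f z)
      (x1 + y1 * Complex.I) (x2 + y2 * Complex.I) {z} (countable_singleton z) ?_ ?_
    · simpa [okaRect] using this
    · intro ζ hζ
      simp [Complex.mem_reProdIm, uIcc_of_le hx.le, uIcc_of_le hy.le] at hζ
      exact (hcd ζ hζ.1 hζ.2).continuousWithinAt
    · intro ζ hζ
      simp [Complex.mem_reProdIm, hx.le, hy.le] at hζ
      exact (differentiableAt_dslope_of_ne hζ.2).2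
        (hf ζ ⟨hζ.1.1.1.le, hζ.1.1.2.le⟩ ⟨hζ.1.2.1.le, hζ.1.2.2.le⟩)
  have h1 : okaRect x1 x2 y1 y2 (fun ζ => f ζ * (ζ - z)⁻¹) =
      okaRect x1 x2 y1 y2 (dslope f z) + f z * okaRect x1 x2 y1 y2 (fun ζ => (ζ - z)⁻¹) := by
    have key : ∀ (γ : ℝ → ℂ) (a b : ℝ), a ≤ b → Continuous γ →
        (∀ t ∈ Icc a b, (γ t).re ∈ Icc x1 x2 ∧ (γ t).im ∈ Icc y1 y2 ∧ γ t ≠ z) →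
        (∫ t in a..b, f (γ t) * (γ t - z)⁻¹) =
          (∫ t in a..b, dslope f z (γ t)) + f z * ∫ t in a..b, (γ t - z)⁻¹ := by
      intro γ a b hab hγ h
      rw [← intervalIntegral.integral_const_mul, ← intervalIntegral.integral_add]
      · refine intervalIntegral.integral_congr fun t ht => ?_
        rw [uIcc_of_le hab] at ht
        have hne := (h t ht).2.2
        rw [dslope_of_ne _ hne, slope_def_field]
        have : γ t - z ≠ 0 := sub_ne_zero.2 hne
        field_simp
        ring
      · refine ContinuousOn.intervalIntegrable fun t ht => ?_
        rw [uIcc_of_le hab] at ht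
        exact (ContinuousAt.comp (hcd _ (h t ht).1 (h t ht).2.1)
          hγ.continuousAt).continuousWithinAt
      · refine ContinuousOn.intervalIntegrable ?_
        rw [uIcc_of_le hab]
        refine continuousOn_const.mul (ContinuousOn.inv₀ (by fun_prop) fun t ht => ?_)
        exact sub_ne_zero.2 (h t ht).2.2
    have kb := key (fun x : ℝ => x + y1 * Complex.I) x1 x2 hx.le (by fun_prop) (by
      intro t ht
      refine ⟨by simpa using ht, by simpa using hy.le, fun h => ?_⟩
      rw [← h] at hy1; simp at hy1)
    have kt := key (fun x : ℝ => x + y2 * Complex.I) x1 x2 hx.le (by fun_prop) (by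
      intro t ht
      refine ⟨by simpa using ht, by simpa using hy.le, fun h => ?_⟩
      rw [← h] at hy2; simp at hy2)
    have kr := key (fun y : ℝ => x2 + y * Complex.I) y1 y2 hy.le (by fun_prop) (by
      intro t ht
      refine ⟨by simpa using hx.le, by simpa using ht, fun h => ?_⟩
      rw [← h] at hx2; simp at hx2)
    have kl := key (fun y : ℝ => x1 + y * Complex.I) y1 y2 hy.le (by fun_prop) (by
      intro t ht
      refine ⟨by simpa using hx.le, by simpa using ht, fun h => ?_⟩
      rw [← h] at hx1; simp at hx1)
    unfold okaRect
    rw [kb, kt, kr, kl]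
    ring
  rw [h1, h0, oka_winding x1 x2 y1 y2 z hx1 hx2 hy1 hy2]
  ring

/-- Quotient of `h` by `w - φ y`. -/
noncomputable def okaQuot {E : Type*} (h : E × ℂ → ℂ) (φ : E → ℂ) (x : E × ℂ) : ℂ :=
  open Classical in
  if x.2 = φ x.1 then deriv (fun w => h (x.1, w)) (φ x.1) else h x / (x.2 - φ x.1)

lemma oka_quot_graph {E : Type*} [NormedAddCommGroup E] [NormedSpace ℂ E] [ProperSpace E]
    (h : E × ℂ → ℂ) (φ : E → ℂ) (hφ : Differentiable ℂ φ) (y0 : E)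
    (hd : ∀ᶠ x in 𝓝 (y0, φ y0), DifferentiableAt ℂ h x)
    (h0 : ∀ᶠ y in 𝓝 y0, h (y, φ y) = 0) :
    ∀ᶠ x in 𝓝 (y0, φ y0), DifferentiableAt ℂ (okaQuot h φ) x := by
  obtain ⟨r, hr, hball⟩ := Metric.eventually_nhds_iff_ball.1 hd
  set ρ := r / 2 with hρ
  have hρ0 : 0 < ρ := by positivity
  have hρr : ρ < r := by rw [hρ]; linarith
  have hmem : ∀ y ∈ ball y0 r, ∀ w ∈ ball (φ y0) r, (y, w) ∈ ball (y0, φ y0) r := by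
    intro y hy w hw
    rw [mem_ball, Prod.dist_eq, max_lt_iff]
    exact ⟨hy, hw⟩
  have hφc : ContinuousAt φ y0 := hφ.continuous.continuousAt
  -- the holomorphic local representation
  have hI : ∀ᶠ x in 𝓝 (y0, φ y0), DifferentiableAt ℂ (fun x : E × ℂ => ∫ θ in (0:ℝ)..(2 * Real.pi),
      (2 * Real.pi * Complex.I : ℂ)⁻¹ * deriv (circleMap (φ y0) ρ) θ *
        ((fun u : (E × ℂ) × ℂ => (u.2 - u.1.2)⁻¹ * (u.2 - φ u.1.1)⁻¹ * h (u.1.1, u.2))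
          (x, circleMap (φ y0) ρ θ))) x := by
    refine oka_param_curve
      (fun u : (E × ℂ) × ℂ => (u.2 - u.1.2)⁻¹ * (u.2 - φ u.1.1)⁻¹ * h (u.1.1, u.2))
      (circleMap (φ y0) ρ) (fun θ => (2 * Real.pi * Complex.I : ℂ)⁻¹ * deriv (circleMap (φ y0) ρ) θ)
      (continuous_circleMap _ _) ?_ _ _ _ ?_
    · simp only [deriv_circleMap]
      have := continuous_circleMap 0 ρ
      fun_prop
    · intro θ _
      have hne : circleMap (φ y0) ρ θ ≠ φ y0 := circleMap_ne_center hρ0.ne'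
      have e1 : ∀ᶠ u : (E × ℂ) × ℂ in 𝓝 ((y0, φ y0), circleMap (φ y0) ρ θ), u.2 - u.1.2 ≠ 0 := by
        refine ContinuousAt.eventually_ne (by fun_prop) ?_
        exact sub_ne_zero.2 hne
      have e2 : ∀ᶠ u : (E × ℂ) × ℂ in 𝓝 ((y0, φ y0), circleMap (φ y0) ρ θ), u.2 - φ u.1.1 ≠ 0 := by
        have := hφ.continuous
        refine ContinuousAt.eventually_ne (by fun_prop) ?_
        exact sub_ne_zero.2 hne
      have e3 : ∀ᶠ u : (E × ℂ) × ℂ in 𝓝 ((y0, φ y0), circleMap (φ y0) ρ θ),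
          DifferentiableAt ℂ h (u.1.1, u.2) := by
        have hc : ContinuousAt (fun u : (E × ℂ) × ℂ => (u.1.1, u.2))
          ((y0, φ y0), circleMap (φ y0) ρ θ) := by fun_prop
        refine hc.eventually (p := fun v => DifferentiableAt ℂ h v) ?_
        refine (isOpen_ball.eventually_mem (hmem y0 (mem_ball_self hr) _ ?_)).mono hball
        exact sphere_subset_closedBall.trans (closedBall_subset_ball hρr)
          (circleMap_mem_sphere _ hρ0.le θ)
      filter_upwards [e1, e2, e3] with u h1 h2 h3
      refine DifferentiableAt.mul (DifferentiableAt.mul ?_ ?_) ?_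
      · exact DifferentiableAt.inv (by fun_prop) h1
      · refine DifferentiableAt.inv ?_ h2
        fun_prop
      · exact DifferentiableAt.comp (f := fun u : (E × ℂ) × ℂ => (u.1.1, u.2)) u h3 (by fun_prop)
  have heq : ∀ᶠ x in 𝓝 (y0, φ y0), okaQuot h φ x = ∫ θ in (0:ℝ)..(2 * Real.pi),
      (2 * Real.pi * Complex.I : ℂ)⁻¹ * deriv (circleMap (φ y0) ρ) θ *
        ((fun u : (E × ℂ) × ℂ => (u.2 - u.1.2)⁻¹ * (u.2 - φ u.1.1)⁻¹ * h (u.1.1, u.2))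
          (x, circleMap (φ y0) ρ θ)) := by
    have f1 : ∀ᶠ x : E × ℂ in 𝓝 (y0, φ y0), x.1 ∈ ball y0 r :=
      continuousAt_fst.eventually (ball_mem_nhds _ hr)
    have f2 : ∀ᶠ x : E × ℂ in 𝓝 (y0, φ y0), x.2 ∈ ball (φ y0) ρ :=
      continuousAt_snd.eventually (ball_mem_nhds _ hρ0)
    have f3 : ∀ᶠ x : E × ℂ in 𝓝 (y0, φ y0), φ x.1 ∈ ball (φ y0) ρ :=
      continuousAt_fst.eventually (p := fun y => φ y ∈ ball (φ y0) ρ)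
        (hφc.eventually (ball_mem_nhds _ hρ0))
    have f4 : ∀ᶠ x : E × ℂ in 𝓝 (y0, φ y0), h (x.1, φ x.1) = 0 :=
      continuousAt_fst.eventually (p := fun y => h (y, φ y) = 0) h0
    filter_upwards [f1, f2, f3, f4] with x g1 g2 g3 g4
    obtain ⟨y, w⟩ := x
    simp only at g1 g2 g3 g4
    have hk : DifferentiableOn ℂ (fun w => h (y, w)) (ball (φ y0) r) := by
      intro w hw
      exact (DifferentiableAt.comp (f := fun w => (y, w)) w (hball _ (hmem y g1 w hw))
        (by fun_prop)).differentiableWithinAt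
    have hds : DifferentiableOn ℂ (dslope (fun w => h (y, w)) (φ y)) (ball (φ y0) r) :=
      (Complex.differentiableOn_dslope (isOpen_ball.mem_nhds (ball_subset_ball hρr.le g3))).2 hk
    have hq : okaQuot h φ (y, w) = dslope (fun w => h (y, w)) (φ y) w := by
      unfold okaQuot
      simp only
      split_ifs with hw
      · rw [hw, dslope_same]
      · rw [dslope_of_ne _ hw, slope_def_field, g4, sub_zero]
    rw [hq, ← (hds.diffContOnCl_ball
      (closedBall_subset_ball hρr)).two_pi_i_inv_smul_circleIntegral_sub_inv_smul g2]
    unfold circleIntegral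
    rw [smul_eq_mul, ← intervalIntegral.integral_const_mul]
    refine intervalIntegral.integral_congr fun θ _ => ?_
    simp only [smul_eq_mul]
    have hne : circleMap (φ y0) ρ θ ≠ φ y := by
      intro hh
      rw [← hh] at g3
      exact absurd (circleMap_mem_sphere (φ y0) hρ0.le θ) (by
        rw [mem_sphere]; exact (mem_ball.1 g3).ne)
    rw [dslope_of_ne _ hne, slope_def_field, g4, sub_zero]
    ring
  filter_upwards [hI, heq.eventually_nhds] with x hx hxe
  exact hx.congr_of_eventuallyEq hxe

lemma oka_quot_off {E : Type*} [NormedAddCommGroup E] [NormedSpace ℂ E]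
    (h : E × ℂ → ℂ) (φ : E → ℂ) (hφ : Differentiable ℂ φ) (x0 : E × ℂ) (hne : x0.2 ≠ φ x0.1)
    (hd : ∀ᶠ x in 𝓝 x0, DifferentiableAt ℂ h x) :
    ∀ᶠ x in 𝓝 x0, DifferentiableAt ℂ (okaQuot h φ) x := by
  have hc := hφ.continuous
  have e1 : ∀ᶠ x : E × ℂ in 𝓝 x0, x.2 - φ x.1 ≠ 0 :=
    ContinuousAt.eventually_ne (by fun_prop) (sub_ne_zero.2 hne)
  filter_upwards [e1.eventually_nhds, hd] with x hx hdx
  have hx0 := hx.self_of_nhds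
  have hq : okaQuot h φ =ᶠ[𝓝 x] fun x => h x / (x.2 - φ x.1) := by
    filter_upwards [hx] with y hy
    unfold okaQuot
    rw [if_neg (sub_ne_zero.1 hy)]
  refine DifferentiableAt.congr_of_eventuallyEq ?_ hq
  simp only [div_eq_mul_inv]
  exact hdx.mul (DifferentiableAt.inv (by fun_prop) hx0)

/-- `f` is holomorphic on a neighborhood of `S`. -/
def okaHol {W : Type*} [NormedAddCommGroup W] [NormedSpace ℂ W] (f : W → ℂ) (S : Set W) : Prop :=
  ∀ x ∈ S, ∀ᶠ y in 𝓝 x, DifferentiableAt ℂ f y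

/-- Real coordinates on `ℂⁿ`. -/
def okaCoord {n : ℕ} (i : Fin n × Bool) (z : Fin n → ℂ) : ℝ :=
  if i.2 = true then (z i.1).re else (z i.1).im

/-- A closed box. -/
def okaBox {n : ℕ} (a b : Fin n × Bool → ℝ) : Set (Fin n → ℂ) :=
  {z | ∀ i, a i ≤ okaCoord i z ∧ okaCoord i z ≤ b i}

/-- The part of a box cut out by the first `k` functions. -/
def okaY {n : ℕ} (p : ℕ → (Fin n → ℂ) → ℂ) (k : ℕ) (a b : Fin n × Bool → ℝ) : Set (Fin n → ℂ) :=
  {z | z ∈ okaBox a b ∧ ∀ i < k, ‖p i z‖ ≤ 1}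

lemma okaCoord_continuous {n : ℕ} (i : Fin n × Bool) : Continuous (okaCoord i) := by
  unfold okaCoord
  split_ifs
  · exact Complex.continuous_re.comp (continuous_apply _)
  · exact Complex.continuous_im.comp (continuous_apply _)

lemma okaBox_isClosed {n : ℕ} (a b : Fin n × Bool → ℝ) : IsClosed (okaBox a b) := by
  have : okaBox a b = ⋂ i, {z | a i ≤ okaCoord i z} ∩ {z | okaCoord i z ≤ b i} := by
    ext z; simp [okaBox]
  rw [this]
  exact isClosed_iInter fun i => (isClosed_le continuous_const (okaCoord_continuous i)).inter
    (isClosed_le (okaCoord_continuous i) continuous_const)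

lemma okaBox_dist {n : ℕ} (a b : Fin n × Bool → ℝ) (δ : ℝ) (hδ : 0 ≤ δ) (h : ∀ i, b i - a i ≤ δ)
    (z w : Fin n → ℂ) (hz : z ∈ okaBox a b) (hw : w ∈ okaBox a b) : dist z w ≤ 2 * δ := by
  refine (dist_pi_le_iff (by positivity)).2 fun j => ?_
  rw [dist_eq_norm]
  refine (Complex.norm_le_abs_re_add_abs_im _).trans ?_
  have h1 := hz (j, true)
  have h2 := hw (j, true)
  have h3 := hz (j, false)
  have h4 := hw (j, false)
  have h5 := h (j, true)
  have h6 := h (j, false)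
  simp only [okaCoord, if_true, Bool.false_eq_true, if_false] at h1 h2 h3 h4
  have g1 : |(z j - w j).re| ≤ δ := by
    rw [Complex.sub_re, abs_le]; constructor <;> linarith
  have g2 : |(z j - w j).im| ≤ δ := by
    rw [Complex.sub_im, abs_le]; constructor <;> linarith
  linarith

lemma okaBox_isCompact {n : ℕ} (a b : Fin n × Bool → ℝ) : IsCompact (okaBox a b) := by
  refine Metric.isCompact_of_isClosed_isBounded (okaBox_isClosed a b) ?_
  rw [Metric.isBounded_iff]
  refine ⟨2 * ∑ i, |b i - a i|, fun z hz w hw => okaBox_dist a b _ ?_ ?_ z w hz hw⟩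
  · positivity
  · intro i
    refine (le_abs_self _).trans ?_
    exact Finset.single_le_sum (f := fun i => |b i - a i|) (fun _ _ => abs_nonneg _)
      (Finset.mem_univ i)

lemma okaY_isCompact {n : ℕ} (p : ℕ → (Fin n → ℂ) → ℂ) (hp : ∀ i, Differentiable ℂ (p i)) (k : ℕ)
    (a b : Fin n × Bool → ℝ) : IsCompact (okaY p k a b) := by
  have : okaY p k a b = okaBox a b ∩ ⋂ i, ⋂ (_ : i < k), {z | ‖p i z‖ ≤ 1} := by
    ext z; simp [okaY]
  rw [this]
  refine (okaBox_isCompact a b).inter_right (isClosed_iInter fun i => isClosed_iInter fun _ => ?_)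
  exact isClosed_le (hp i).continuous.norm continuous_const

/-- The splitting (Cousin) property. -/
def OkaSplit {n : ℕ} (p : ℕ → (Fin n → ℂ) → ℂ) (k : ℕ) : Prop :=
  ∀ (P : Type) [NormedAddCommGroup P] [NormedSpace ℂ P] [ProperSpace P] (K : Set P), IsCompact K →
    ∀ (a b : Fin n × Bool → ℝ) (i : Fin n × Bool) (c : ℝ) (g : (Fin n → ℂ) × P → ℂ),
    okaHol g (okaY p k (Function.update a i c) (Function.update b i c) ×ˢ K) →
    ∃ g1 g2 : (Fin n → ℂ) × P → ℂ, okaHol g1 (okaY p k a (Function.update b i c) ×ˢ K) ∧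
      okaHol g2 (okaY p k (Function.update a i c) b ×ˢ K) ∧
      ∀ x ∈ okaY p k (Function.update a i c) (Function.update b i c) ×ˢ K,
        ∀ᶠ y in 𝓝 x, g y = g1 y - g2 y

/-- A Cauchy type integral along a curve. -/
noncomputable def okaSide {n : ℕ} {P : Type} (g : (Fin n → ℂ) × P → ℂ) (j : Fin n) (κ : ℂ)
    (γ : ℝ → ℂ) (s t : ℝ) (x : (Fin n → ℂ) × P) : ℂ :=
  ∫ τ in s..t, κ * (g (Function.update x.1 j (γ τ), x.2) * (γ τ - x.1 j)⁻¹)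

lemma okaSide_diff {n : ℕ} {P : Type} [NormedAddCommGroup P] [NormedSpace ℂ P] [ProperSpace P]
    (g : (Fin n → ℂ) × P → ℂ) (j : Fin n) (κ : ℂ) (γ : ℝ → ℂ) (hγ : Continuous γ) (s t : ℝ)
    (hst : s ≤ t) (x0 : (Fin n → ℂ) × P)
    (h : ∀ τ ∈ Icc s t, γ τ ≠ x0.1 j ∧
      ∀ᶠ y in 𝓝 (Function.update x0.1 j (γ τ), x0.2), DifferentiableAt ℂ g y) :
    ∀ᶠ x in 𝓝 x0, DifferentiableAt ℂ (okaSide g j κ γ s t) x := by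
  have hupd : Differentiable ℂ (fun u : ((Fin n → ℂ) × P) × ℂ => (Function.update u.1.1 j u.2, u.1.2)) := by
    refine Differentiable.prodMk ?_ (by fun_prop)
    rw [differentiable_pi]
    intro i
    rcases eq_or_ne i j with rfl | hij
    · simp only [Function.update_self]; fun_prop
    · simp only [Function.update_of_ne hij]; fun_prop
  refine oka_param_curve (fun u : ((Fin n → ℂ) × P) × ℂ =>
    g (Function.update u.1.1 j u.2, u.1.2) * (u.2 - u.1.1 j)⁻¹) γ (fun _ => κ) hγ continuous_const
    s t x0 ?_
  intro τ hτ
  rw [uIcc_of_le hst] at hτ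
  obtain ⟨h1, h2⟩ := h τ hτ
  have e1 : ∀ᶠ u : ((Fin n → ℂ) × P) × ℂ in 𝓝 (x0, γ τ), u.2 - u.1.1 j ≠ 0 :=
    ContinuousAt.eventually_ne (by fun_prop) (sub_ne_zero.2 h1)
  have e2 : ∀ᶠ u : ((Fin n → ℂ) × P) × ℂ in 𝓝 (x0, γ τ),
      DifferentiableAt ℂ g (Function.update u.1.1 j u.2, u.1.2) :=
    (hupd.continuous.continuousAt (x := (x0, γ τ))).eventually h2
  filter_upwards [e1, e2] with u hu1 hu2
  refine DifferentiableAt.mul ?_ (DifferentiableAt.inv (by fun_prop) hu1)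
  exact DifferentiableAt.comp u hu2 hupd.differentiableAt

lemma okaHol_empty {W : Type*} [NormedAddCommGroup W] [NormedSpace ℂ W] (f : W → ℂ) :
    okaHol f (∅ : Set W) := fun _ hx => hx.elim

lemma oka_split_zero {n : ℕ} (p : ℕ → (Fin n → ℂ) → ℂ) : OkaSplit p 0 := by
  intro P _ _ _ K hK a b i c g hg
  have hY0 : ∀ a b, okaY p 0 a b = okaBox a b := by intro a b; ext z; simp [okaY]
  simp only [hY0] at hg ⊢
  set a' := Function.update a i c with ha'
  set b' := Function.update b i c with hb'
  obtain ⟨j, β⟩ := i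
  by_cases hbad : b (j, !β) < a (j, !β)
  · have hne : (j, !β) ≠ (j, β) := by simp
    refine ⟨0, 0, ?_, ?_, ?_⟩
    · rintro x ⟨hx, _⟩
      have := hx (j, !β)
      rw [hb', Function.update_of_ne hne] at this
      linarith
    · rintro x ⟨hx, _⟩
      have := hx (j, !β)
      rw [ha', Function.update_of_ne hne] at this
      linarith
    · rintro x ⟨hx, _⟩
      have := hx (j, !β)
      rw [ha', hb', Function.update_of_ne hne, Function.update_of_ne hne] at this
      linarith
  push Not at hbad
  have hab' : ∀ β', a' (j, β') ≤ b' (j, β') := by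
    intro β'
    by_cases h : β' = β
    · subst h; simp [ha', hb']
    · have h2 : β' = !β := by cases β <;> cases β' <;> simp_all
      subst h2
      have hne : (j, !β) ≠ (j, β) := by simp
      rw [ha', hb', Function.update_of_ne hne, Function.update_of_ne hne]
      exact hbad
  -- open set of holomorphy
  set Ω : Set ((Fin n → ℂ) × P) := {x | ∀ᶠ y in 𝓝 x, DifferentiableAt ℂ g y} with hΩ
  have hΩo : IsOpen Ω := isOpen_setOfPred_eventually_nhds
  obtain ⟨δ, hδ, hsub⟩ := ((okaBox_isCompact a' b').prod hK).exists_cthickening_subset_open hΩo hg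
  set ε := δ / 2 with hε
  have hε0 : 0 < ε := by positivity
  set x1 := a' (j, true) - ε with hx1
  set x2 := b' (j, true) + ε with hx2
  set y1 := a' (j, false) - ε with hy1
  set y2 := b' (j, false) + ε with hy2
  have hT := hab' true
  have hF := hab' false
  have hx12 : x1 ≤ x2 := by rw [hx1, hx2]; linarith
  have hy12 : y1 ≤ y2 := by rw [hy1, hy2]; linarith
  have hin : ∀ z : Fin n → ℂ, (∀ i : Fin n × Bool, i.1 ≠ j → a i ≤ okaCoord i z ∧ okaCoord i z ≤ b i) →
      ∀ q ∈ K, ∀ ζ : ℂ, ζ.re ∈ Icc x1 x2 → ζ.im ∈ Icc y1 y2 → (Function.update z j ζ, q) ∈ Ω := by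
    intro z hz q hq ζ h1 h2
    refine hsub ?_
    set ζ' : ℂ := ⟨max (a' (j, true)) (min (b' (j, true)) ζ.re),
      max (a' (j, false)) (min (b' (j, false)) ζ.im)⟩ with hζ'
    refine mem_cthickening_of_dist_le (Function.update z j ζ, q) (Function.update z j ζ', q) δ _ ?_ ?_
    · refine ⟨?_, hq⟩
      rintro ⟨i, β'⟩
      by_cases hij : i = j
      · subst hij
        cases β'
        · simp only [okaCoord, Function.update_self, hζ', Bool.false_eq_true, if_false]
          exact ⟨le_max_left _ _, max_le hF (min_le_left _ _)⟩
        · simp only [okaCoord, Function.update_self, hζ', if_true]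
          exact ⟨le_max_left _ _, max_le hT (min_le_left _ _)⟩
      · have hne : (i, β') ≠ (j, β) := by simp [hij]
        have : okaCoord (i, β') (Function.update z j ζ') = okaCoord (i, β') z := by
          simp [okaCoord, Function.update_of_ne hij]
        simp only [this, ha', hb', Function.update_of_ne hne]
        exact hz (i, β') hij
    · rw [Prod.dist_eq, dist_self, max_le_iff]
      refine ⟨(dist_pi_le_iff hδ.le).2 fun i => ?_, hδ.le⟩
      by_cases hij : i = j
      · subst hij
        simp only [Function.update_self]
        rw [dist_eq_norm]
        refine (Complex.norm_le_abs_re_add_abs_im _).trans ?_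
        have g1 : |(ζ - ζ').re| ≤ ε := by
          simp only [Complex.sub_re, hζ', hx1, hx2, mem_Icc] at *
          rw [abs_le]
          constructor <;> rcases max_cases (a' (i, true)) (min (b' (i, true)) ζ.re) with h | h <;>
            rcases min_cases (b' (i, true)) ζ.re with h' | h' <;> linarith
        have g2 : |(ζ - ζ').im| ≤ ε := by
          simp only [Complex.sub_im, hζ', hy1, hy2, mem_Icc] at *
          rw [abs_le]
          constructor <;> rcases max_cases (a' (i, false)) (min (b' (i, false)) ζ.im) with h | h <;>
            rcases min_cases (b' (i, false)) ζ.im with h' | h' <;> linarith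
        linarith
      · simp [Function.update_of_ne hij, hδ.le]
  set κ : ℂ := (2 * Real.pi * Complex.I)⁻¹ with hκ
  have hκ0 : (2 * Real.pi * Complex.I : ℂ) ≠ 0 := Complex.two_pi_I_ne_zero
  set SB := okaSide g j κ (fun t : ℝ => (t : ℂ) + y1 * Complex.I) x1 x2 with hSB
  set ST := okaSide g j (-κ) (fun t : ℝ => (t : ℂ) + y2 * Complex.I) x1 x2 with hST
  set SR := okaSide g j (κ * Complex.I) (fun t : ℝ => (x2 : ℂ) + t * Complex.I) y1 y2 with hSR
  set SL := okaSide g j (-(κ * Complex.I)) (fun t : ℝ => (x1 : ℂ) + t * Complex.I) y1 y2 with hSL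
  have hBd : ∀ x : (Fin n → ℂ) × P, (∀ i : Fin n × Bool, i.1 ≠ j → a i ≤ okaCoord i x.1 ∧
      okaCoord i x.1 ≤ b i) → x.2 ∈ K → (x.1 j).im ≠ y1 → ∀ᶠ y in 𝓝 x, DifferentiableAt ℂ SB y := by
    intro x hx hxK hne
    refine okaSide_diff g j _ _ (by fun_prop) _ _ hx12 x fun t ht => ⟨fun h => hne ?_, ?_⟩
    · rw [← h]; simp
    · exact hin x.1 hx x.2 hxK _ (by simpa using ht) (by simpa using hy12)
  have hTd : ∀ x : (Fin n → ℂ) × P, (∀ i : Fin n × Bool, i.1 ≠ j → a i ≤ okaCoord i x.1 ∧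
      okaCoord i x.1 ≤ b i) → x.2 ∈ K → (x.1 j).im ≠ y2 → ∀ᶠ y in 𝓝 x, DifferentiableAt ℂ ST y := by
    intro x hx hxK hne
    refine okaSide_diff g j _ _ (by fun_prop) _ _ hx12 x fun t ht => ⟨fun h => hne ?_, ?_⟩
    · rw [← h]; simp
    · exact hin x.1 hx x.2 hxK _ (by simpa using ht) (by simpa using hy12)
  have hRd : ∀ x : (Fin n → ℂ) × P, (∀ i : Fin n × Bool, i.1 ≠ j → a i ≤ okaCoord i x.1 ∧
      okaCoord i x.1 ≤ b i) → x.2 ∈ K → (x.1 j).re ≠ x2 → ∀ᶠ y in 𝓝 x, DifferentiableAt ℂ SR y := by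
    intro x hx hxK hne
    refine okaSide_diff g j _ _ (by fun_prop) _ _ hy12 x fun t ht => ⟨fun h => hne ?_, ?_⟩
    · rw [← h]; simp
    · exact hin x.1 hx x.2 hxK _ (by simpa using hx12) (by simpa using ht)
  have hLd : ∀ x : (Fin n → ℂ) × P, (∀ i : Fin n × Bool, i.1 ≠ j → a i ≤ okaCoord i x.1 ∧
      okaCoord i x.1 ≤ b i) → x.2 ∈ K → (x.1 j).re ≠ x1 → ∀ᶠ y in 𝓝 x, DifferentiableAt ℂ SL y := by
    intro x hx hxK hne
    refine okaSide_diff g j _ _ (by fun_prop) _ _ hy12 x fun t ht => ⟨fun h => hne ?_, ?_⟩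
    · rw [← h]; simp
    · exact hin x.1 hx x.2 hxK _ (by simpa using hx12) (by simpa using ht)
  -- the Cauchy formula
  have hsum : ∀ x ∈ okaBox a' b' ×ˢ K, ∀ᶠ y in 𝓝 x, g y = SB y + ST y + SR y + SL y := by
    rintro ⟨z0, q0⟩ ⟨hz0, hq0⟩
    have hz0' : ∀ i : Fin n × Bool, i.1 ≠ j → a i ≤ okaCoord i z0 ∧ okaCoord i z0 ≤ b i := by
      intro i hij
      have hne : i ≠ (j, β) := by rintro rfl; exact hij rfl
      have := hz0 i
      simpa only [ha', hb', Function.update_of_ne hne] using this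
    have hre := hz0 (j, true)
    have him := hz0 (j, false)
    simp only [okaCoord, if_true, Bool.false_eq_true, if_false] at hre him
    have hcomp : IsCompact (Icc x1 x2 ×ℂ Icc y1 y2) := isCompact_Icc.reProdIm isCompact_Icc
    have hev : ∀ᶠ x : (Fin n → ℂ) × P in 𝓝 (z0, q0), ∀ ζ ∈ Icc x1 x2 ×ℂ Icc y1 y2,
        DifferentiableAt ℂ g (Function.update x.1 j ζ, x.2) := by
      refine hcomp.eventually_forall_of_forall_eventually
        (P := fun (x : (Fin n → ℂ) × P) ζ => DifferentiableAt ℂ g (Function.update x.1 j ζ, x.2)) fun ζ hζ => ?_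
      have hc : Continuous (fun u : ((Fin n → ℂ) × P) × ℂ => (Function.update u.1.1 j u.2, u.1.2)) := by
        fun_prop
      exact (hc.continuousAt (x := ((z0, q0), ζ))).eventually (hin z0 hz0' q0 hq0 ζ hζ.1 hζ.2)
    have hcj : Continuous (fun x : (Fin n → ℂ) × P => x.1 j) := by fun_prop
    have hcre : Continuous (fun x : (Fin n → ℂ) × P => (x.1 j).re) := Complex.continuous_re.comp hcj
    have hcim : Continuous (fun x : (Fin n → ℂ) × P => (x.1 j).im) := Complex.continuous_im.comp hcj
    have e1 : ∀ᶠ x : (Fin n → ℂ) × P in 𝓝 (z0, q0), x1 < (x.1 j).re :=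
      hcre.continuousAt.eventually (lt_mem_nhds (by rw [hx1]; simp only; linarith))
    have e2 : ∀ᶠ x : (Fin n → ℂ) × P in 𝓝 (z0, q0), (x.1 j).re < x2 :=
      hcre.continuousAt.eventually (gt_mem_nhds (by rw [hx2]; simp only; linarith))
    have e3 : ∀ᶠ x : (Fin n → ℂ) × P in 𝓝 (z0, q0), y1 < (x.1 j).im :=
      hcim.continuousAt.eventually (lt_mem_nhds (by rw [hy1]; simp only; linarith))
    have e4 : ∀ᶠ x : (Fin n → ℂ) × P in 𝓝 (z0, q0), (x.1 j).im < y2 :=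
      hcim.continuousAt.eventually (gt_mem_nhds (by rw [hy2]; simp only; linarith))
    filter_upwards [hev, e1, e2, e3, e4] with x hx f1 f2 f3 f4
    have := oka_rect_cauchy x1 x2 y1 y2 (x.1 j) (fun ζ => g (Function.update x.1 j ζ, x.2))
      f1 f2 f3 f4 (by
        intro ζ h1 h2
        have h3 := hx ζ ⟨h1, h2⟩
        refine DifferentiableAt.comp (f := fun ζ => (Function.update x.1 j ζ, x.2)) ζ h3 ?_
        refine DifferentiableAt.prodMk ?_ (by fun_prop)
        rw [differentiableAt_pi]
        intro i
        rcases eq_or_ne i j with rfl | hij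
        · simp only [Function.update_self]; fun_prop
        · simp only [Function.update_of_ne hij]; fun_prop)
    simp only [Function.update_eq_self] at this
    have h5 : g x = κ * (2 * Real.pi * Complex.I * g (x.1, x.2)) := by
      rw [hκ, ← mul_assoc, inv_mul_cancel₀ hκ0, one_mul]
    rw [h5, ← this]
    simp only [okaRect, hSB, hST, hSR, hSL, okaSide, intervalIntegral.integral_const_mul]
    ring
  have hoff1 : ∀ z ∈ okaBox a b', ∀ i : Fin n × Bool, i.1 ≠ j → a i ≤ okaCoord i z ∧ okaCoord i z ≤ b i := by
    intro z hz i hij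
    have hne : i ≠ (j, β) := by rintro rfl; exact hij rfl
    have := hz i
    simpa only [hb', Function.update_of_ne hne] using this
  have hoff2 : ∀ z ∈ okaBox a' b, ∀ i : Fin n × Bool, i.1 ≠ j → a i ≤ okaCoord i z ∧ okaCoord i z ≤ b i := by
    intro z hz i hij
    have hne : i ≠ (j, β) := by rintro rfl; exact hij rfl
    have := hz i
    simpa only [ha', Function.update_of_ne hne] using this
  cases β
  · -- cut in the imaginary direction
    have hb1 : b' (j, true) = b (j, true) := by simp [hb']
    refine ⟨ST, fun y => -(SB y + SR y + SL y), ?_, ?_, ?_⟩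
    · rintro x ⟨hx, hxK⟩
      refine hTd x (hoff1 _ hx) hxK ?_
      have := (hx (j, false)).2
      simp only [okaCoord, Bool.false_eq_true, if_false] at this
      rw [hy2]; linarith
    · rintro x ⟨hx, hxK⟩
      have h1 := hx (j, false)
      have h2 := hx (j, true)
      simp only [okaCoord, Bool.false_eq_true, if_false, if_true] at h1 h2
      filter_upwards [hBd x (hoff2 _ hx) hxK (by rw [hy1]; linarith),
        hRd x (hoff2 _ hx) hxK (by rw [hx2]; linarith),
        hLd x (hoff2 _ hx) hxK (by rw [hx1]; linarith)] with y hy1 hy2 hy3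
      exact ((hy1.add hy2).add hy3).neg
    · intro x hx
      filter_upwards [hsum x hx] with y hy
      rw [hy]; ring
  · have hb1 : b' (j, false) = b (j, false) := by simp [hb']
    refine ⟨SR, fun y => -(SB y + ST y + SL y), ?_, ?_, ?_⟩
    · rintro x ⟨hx, hxK⟩
      refine hRd x (hoff1 _ hx) hxK ?_
      have := (hx (j, true)).2
      simp only [okaCoord, if_true] at this
      rw [hx2]; linarith
    · rintro x ⟨hx, hxK⟩
      have h1 := hx (j, false)
      have h2 := hx (j, true)
      simp only [okaCoord, Bool.false_eq_true, if_false, if_true] at h1 h2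
      filter_upwards [hBd x (hoff2 _ hx) hxK (by rw [hy1]; linarith),
        hTd x (hoff2 _ hx) hxK (by rw [hy2]; linarith),
        hLd x (hoff2 _ hx) hxK (by rw [hx1]; linarith)] with y hy1 hy2 hy3
      exact ((hy1.add hy2).add hy3).neg
    · intro x hx
      filter_upwards [hsum x hx] with y hy
      rw [hy]; ring

/-- The extension property over a box. -/
def OkaExt {n : ℕ} (p : ℕ → (Fin n → ℂ) → ℂ) (k : ℕ) {P : Type} [NormedAddCommGroup P]
    [NormedSpace ℂ P] (K : Set P) (f : (Fin n → ℂ) × P → ℂ) (a b : Fin n × Bool → ℝ) : Prop :=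
  ∃ h : (Fin n → ℂ) × (P × ℂ) → ℂ, okaHol h (okaY p k a b ×ˢ (K ×ˢ closedBall (0 : ℂ) 1)) ∧
    ∀ x ∈ okaY p (k + 1) a b ×ˢ K, ∀ᶠ y in 𝓝 x, h (y.1, (y.2, p k y.1)) = f y

lemma okaBox_mono {n : ℕ} {a b a' b' : Fin n × Bool → ℝ} (ha : ∀ i, a i ≤ a' i)
    (hb : ∀ i, b' i ≤ b i) : okaBox a' b' ⊆ okaBox a b :=
  fun _ hz i => ⟨(ha i).trans (hz i).1, (hz i).2.trans (hb i)⟩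

lemma okaY_mono {n : ℕ} (p : ℕ → (Fin n → ℂ) → ℂ) (k : ℕ) {a b a' b' : Fin n × Bool → ℝ}
    (ha : ∀ i, a i ≤ a' i) (hb : ∀ i, b' i ≤ b i) : okaY p k a' b' ⊆ okaY p k a b :=
  fun _ hz => ⟨okaBox_mono ha hb hz.1, hz.2⟩

lemma oka_le_update {ι : Type*} [DecidableEq ι] (a : ι → ℝ) (i : ι) (c : ℝ) (h : a i ≤ c) (j : ι) :
    a j ≤ Function.update a i c j := by
  by_cases hj : j = i
  · subst hj; simpa using h
  · rw [Function.update_of_ne hj]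

lemma oka_update_le {ι : Type*} [DecidableEq ι] (a : ι → ℝ) (i : ι) (c : ℝ) (h : c ≤ a i) (j : ι) :
    Function.update a i c j ≤ a j := by
  by_cases hj : j = i
  · subst hj; simpa using h
  · rw [Function.update_of_ne hj]

lemma okaY_cut_left {n : ℕ} (p : ℕ → (Fin n → ℂ) → ℂ) (k : ℕ) {a b : Fin n × Bool → ℝ}
    {i : Fin n × Bool} {c : ℝ} {z : Fin n → ℂ} (hz : z ∈ okaY p k a b) (h : okaCoord i z ≤ c) :
    z ∈ okaY p k a (Function.update b i c) := by
  refine ⟨fun j => ⟨(hz.1 j).1, ?_⟩, hz.2⟩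
  by_cases hj : j = i
  · subst hj; simpa using h
  · rw [Function.update_of_ne hj]; exact (hz.1 j).2

lemma okaY_cut_right {n : ℕ} (p : ℕ → (Fin n → ℂ) → ℂ) (k : ℕ) {a b : Fin n × Bool → ℝ}
    {i : Fin n × Bool} {c : ℝ} {z : Fin n → ℂ} (hz : z ∈ okaY p k a b) (h : c ≤ okaCoord i z) :
    z ∈ okaY p k (Function.update a i c) b := by
  refine ⟨fun j => ⟨?_, (hz.1 j).2⟩, hz.2⟩
  by_cases hj : j = i
  · subst hj; simpa using h
  · rw [Function.update_of_ne hj]; exact (hz.1 j).1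

lemma okaY_succ {n : ℕ} (p : ℕ → (Fin n → ℂ) → ℂ) (k : ℕ) {a b : Fin n × Bool → ℝ}
    {z : Fin n → ℂ} : z ∈ okaY p (k + 1) a b ↔ z ∈ okaY p k a b ∧ ‖p k z‖ ≤ 1 := by
  constructor
  · intro hz
    exact ⟨⟨hz.1, fun i hi => hz.2 i (by omega)⟩, hz.2 k (by omega)⟩
  · rintro ⟨hz, hk⟩
    refine ⟨hz.1, fun i hi => ?_⟩
    rcases Nat.lt_succ_iff_lt_or_eq.1 hi with h | rfl
    · exact hz.2 i h
    · exact hk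

lemma oka_glue {n : ℕ} (p : ℕ → (Fin n → ℂ) → ℂ) (hp : ∀ i, Differentiable ℂ (p i)) (k : ℕ)
    (hs : OkaSplit p k) {P : Type} [NormedAddCommGroup P] [NormedSpace ℂ P] [ProperSpace P]
    (K : Set P) (hK : IsCompact K) (f : (Fin n → ℂ) × P → ℂ) (a b : Fin n × Bool → ℝ)
    (i : Fin n × Bool) (c : ℝ) (hac : a i ≤ c) (hcb : c ≤ b i)
    (hl : OkaExt p k K f a (Function.update b i c)) (hr : OkaExt p k K f (Function.update a i c) b) :
    OkaExt p k K f a b := by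
  obtain ⟨h1, hh1, he1⟩ := hl
  obtain ⟨h2, hh2, he2⟩ := hr
  set a' := Function.update a i c with ha'
  set b' := Function.update b i c with hb'
  have haa : ∀ j, a j ≤ a' j := oka_le_update a i c hac
  have hbb : ∀ j, b' j ≤ b j := oka_update_le b i c hcb
  set D := closedBall (0 : ℂ) 1 with hD
  set φ : (Fin n → ℂ) × P → ℂ := fun y => p k y.1 with hφ
  have hφd : Differentiable ℂ φ := (hp k).comp differentiable_fst
  set hd : ((Fin n → ℂ) × P) × ℂ → ℂ := fun u => h1 (u.1.1, (u.1.2, u.2)) - h2 (u.1.1, (u.1.2, u.2)) with hhd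
  set A : (Fin n → ℂ) × (P × ℂ) → ((Fin n → ℂ) × P) × ℂ := fun x => ((x.1, x.2.1), x.2.2) with hA
  have hAd : Differentiable ℂ A := by rw [hA]; fun_prop
  set B : ((Fin n → ℂ) × P) × ℂ → (Fin n → ℂ) × (P × ℂ) := fun u => (u.1.1, (u.1.2, u.2)) with hB
  have hBd : Differentiable ℂ B := by rw [hB]; fun_prop
  set g : (Fin n → ℂ) × (P × ℂ) → ℂ := fun x => okaQuot hd φ (A x) with hg
  have hhd1 : ∀ x ∈ okaY p k a' b' ×ˢ (K ×ˢ D), ∀ᶠ u in 𝓝 (A x), DifferentiableAt ℂ hd u := by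
    rintro x ⟨hx, hxK⟩
    have f1 := hh1 x ⟨okaY_mono p k haa (fun _ => le_rfl) hx, hxK⟩
    have f2 := hh2 x ⟨okaY_mono p k (fun _ => le_rfl) hbb hx, hxK⟩
    have hc : Tendsto B (𝓝 (A x)) (𝓝 x) := hBd.continuous.continuousAt (x := A x)
    filter_upwards [hc.eventually f1, hc.eventually f2] with u hu1 hu2
    exact (DifferentiableAt.comp u hu1 hBd.differentiableAt).sub
      (DifferentiableAt.comp u hu2 hBd.differentiableAt)
  have hzero : ∀ x ∈ okaY p k a' b' ×ˢ (K ×ˢ D), x.2.2 = p k x.1 →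
      ∀ᶠ y in 𝓝 (x.1, x.2.1), hd (y, φ y) = 0 := by
    rintro x ⟨hx, hxK⟩ hgr
    have hx1 : x.1 ∈ okaY p (k + 1) a' b' := by
      refine (okaY_succ p k).2 ⟨hx, ?_⟩
      rw [← hgr]; simpa [hD] using hxK.2
    filter_upwards [he1 (x.1, x.2.1) ⟨okaY_mono p _ haa (fun _ => le_rfl) hx1, hxK.1⟩,
      he2 (x.1, x.2.1) ⟨okaY_mono p _ (fun _ => le_rfl) hbb hx1, hxK.1⟩] with y hy1 hy2
    simp only [hhd, hφ]
    rw [hy1, hy2, sub_self]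
  have hgH : okaHol g (okaY p k a' b' ×ˢ (K ×ˢ D)) := by
    intro x hx
    have hq : ∀ᶠ u in 𝓝 (A x), DifferentiableAt ℂ (okaQuot hd φ) u := by
      by_cases hgr : x.2.2 = p k x.1
      · have e : A x = ((x.1, x.2.1), φ (x.1, x.2.1)) := by simp [hA, hφ, hgr]
        have := hhd1 x hx
        rw [e] at this ⊢
        exact oka_quot_graph hd φ hφd _ this (hzero x hx hgr)
      · exact oka_quot_off hd φ hφd (A x) hgr (hhd1 x hx)
    have hc : Tendsto A (𝓝 x) (𝓝 (A x)) := hAd.continuous.continuousAt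
    filter_upwards [hc.eventually hq] with y hy
    exact DifferentiableAt.comp y hy hAd.differentiableAt
  have hgmul : ∀ x ∈ okaY p k a' b' ×ˢ (K ×ˢ D), ∀ᶠ y in 𝓝 x,
      (y.2.2 - p k y.1) * g y = h1 y - h2 y := by
    intro x hx
    have off : ∀ y : (Fin n → ℂ) × (P × ℂ), y.2.2 ≠ p k y.1 →
        (y.2.2 - p k y.1) * g y = h1 y - h2 y := by
      intro y hy
      have : g y = (h1 y - h2 y) / (y.2.2 - p k y.1) := by
        simp only [hg, okaQuot, hA, hφ, hhd]
        rw [if_neg hy]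
      rw [this, mul_div_cancel₀ _ (sub_ne_zero.2 hy)]
    by_cases hgr : x.2.2 = p k x.1
    · have hc : Tendsto (fun y : (Fin n → ℂ) × (P × ℂ) => (y.1, y.2.1)) (𝓝 x) (𝓝 (x.1, x.2.1)) :=
        Continuous.continuousAt (by fun_prop)
      filter_upwards [hc.eventually (hzero x hx hgr)] with y hy
      by_cases hy2 : y.2.2 = p k y.1
      · rw [hy2, sub_self, zero_mul]
        simp only [hhd, hφ] at hy
        rw [← hy2] at hy
        exact hy.symm
      · exact off y hy2
    · have hpc := (hp k).continuous
      have e1 : ∀ᶠ y : (Fin n → ℂ) × (P × ℂ) in 𝓝 x, y.2.2 - p k y.1 ≠ 0 :=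
        ContinuousAt.eventually_ne (by fun_prop) (sub_ne_zero.2 hgr)
      filter_upwards [e1] with y hy using off y (sub_ne_zero.1 hy)
  obtain ⟨g1, g2, hg1, hg2, hgs⟩ := hs (P × ℂ) (K ×ˢ D) (hK.prod (isCompact_closedBall _ _)) a b i c g hgH
  have hpk : Differentiable ℂ (fun y : (Fin n → ℂ) × (P × ℂ) => y.2.2 - p k y.1) := by
    have := hp k
    fun_prop
  set H1 : (Fin n → ℂ) × (P × ℂ) → ℂ := fun y => h1 y - (y.2.2 - p k y.1) * g1 y with hH1
  set H2 : (Fin n → ℂ) × (P × ℂ) → ℂ := fun y => h2 y - (y.2.2 - p k y.1) * g2 y with hH2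
  have hH1d : okaHol H1 (okaY p k a b' ×ˢ (K ×ˢ D)) := by
    intro x hx
    filter_upwards [hh1 x hx, hg1 x hx] with y hy1 hy2
    exact hy1.sub (hpk.differentiableAt.mul hy2)
  have hH2d : okaHol H2 (okaY p k a' b ×ˢ (K ×ˢ D)) := by
    intro x hx
    filter_upwards [hh2 x hx, hg2 x hx] with y hy1 hy2
    exact hy1.sub (hpk.differentiableAt.mul hy2)
  have hH12 : ∀ x ∈ okaY p k a' b' ×ˢ (K ×ˢ D), ∀ᶠ y in 𝓝 x, H1 y = H2 y := by
    intro x hx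
    filter_upwards [hgmul x hx, hgs x hx] with y hy1 hy2
    simp only [hH1, hH2]
    rw [hy2] at hy1
    linear_combination -hy1
  have hcc : Continuous (fun y : (Fin n → ℂ) × (P × ℂ) => okaCoord i y.1) :=
    (okaCoord_continuous i).comp continuous_fst
  have hcc' : Continuous (fun y : (Fin n → ℂ) × P => okaCoord i y.1) :=
    (okaCoord_continuous i).comp continuous_fst
  refine ⟨fun y => if okaCoord i y.1 ≤ c then H1 y else H2 y, ?_, ?_⟩
  · rintro x ⟨hx, hxK⟩
    have fin : ∀ F : (Fin n → ℂ) × (P × ℂ) → ℂ, (∀ᶠ y in 𝓝 x, DifferentiableAt ℂ F y) →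
        (∀ᶠ y in 𝓝 x, (if okaCoord i y.1 ≤ c then H1 y else H2 y) = F y) →
        ∀ᶠ y in 𝓝 x, DifferentiableAt ℂ
          (fun y : (Fin n → ℂ) × (P × ℂ) => if okaCoord i y.1 ≤ c then H1 y else H2 y) y := by
      intro F hF hFe
      filter_upwards [hF, hFe.eventually_nhds] with y hy1 hy2
      exact hy1.congr_of_eventuallyEq hy2
    rcases lt_trichotomy (okaCoord i x.1) c with hlt | heq | hgt
    · refine fin H1 (hH1d x ⟨okaY_cut_left p k hx hlt.le, hxK⟩) ?_
      filter_upwards [hcc.continuousAt.eventually (gt_mem_nhds hlt)] with y hy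
      rw [if_pos (le_of_lt hy)]
    · refine fin H1 (hH1d x ⟨okaY_cut_left p k hx heq.le, hxK⟩) ?_
      filter_upwards [hH12 x ⟨okaY_cut_right p k (okaY_cut_left p k hx heq.le) heq.ge, hxK⟩] with y hy
      split_ifs
      · rfl
      · exact hy.symm
    · refine fin H2 (hH2d x ⟨okaY_cut_right p k hx hgt.le, hxK⟩) ?_
      filter_upwards [hcc.continuousAt.eventually (lt_mem_nhds hgt)] with y hy
      rw [if_neg (not_le.2 hy)]
  · rintro x ⟨hx, hxK⟩
    have r1 : ∀ y : (Fin n → ℂ) × P, H1 (y.1, (y.2, p k y.1)) = h1 (y.1, (y.2, p k y.1)) := by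
      intro y; simp [hH1]
    have r2 : ∀ y : (Fin n → ℂ) × P, H2 (y.1, (y.2, p k y.1)) = h2 (y.1, (y.2, p k y.1)) := by
      intro y; simp [hH2]
    simp only [r1, r2]
    rcases lt_trichotomy (okaCoord i x.1) c with hlt | heq | hgt
    · filter_upwards [hcc'.continuousAt.eventually (gt_mem_nhds hlt),
        he1 x ⟨okaY_cut_left p _ hx hlt.le, hxK⟩] with y hy hy1
      rw [if_pos (le_of_lt hy), hy1]
    · filter_upwards [he1 x ⟨okaY_cut_left p _ hx heq.le, hxK⟩,
        he2 x ⟨okaY_cut_right p _ hx heq.ge, hxK⟩] with y hy1 hy2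
      rw [hy1, hy2, ite_self]
    · filter_upwards [hcc'.continuousAt.eventually (lt_mem_nhds hgt),
        he2 x ⟨okaY_cut_right p _ hx hgt.le, hxK⟩] with y hy hy1
      rw [if_neg (not_le.2 hy), hy1]

/-- Small boxes have the extension property. -/
lemma oka_local {n : ℕ} (p : ℕ → (Fin n → ℂ) → ℂ) (hp : ∀ i, Differentiable ℂ (p i)) (k : ℕ)
    {P : Type} [NormedAddCommGroup P] [NormedSpace ℂ P] [ProperSpace P]
    (K : Set P) (hK : IsCompact K) (f : (Fin n → ℂ) × P → ℂ) (a b : Fin n × Bool → ℝ)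
    (hf : okaHol f (okaY p (k + 1) a b ×ˢ K)) :
    ∃ δ > 0, ∀ a' b' : Fin n × Bool → ℝ, (∀ i, a i ≤ a' i) → (∀ i, b' i ≤ b i) →
      (∀ i, b' i - a' i ≤ δ) → OkaExt p k K f a' b' := by
  set O : Set (Fin n → ℂ) := {z | ∀ᶠ z' in 𝓝 z, ∀ q ∈ K, ∀ᶠ y in 𝓝 (z', q), DifferentiableAt ℂ f y} with hO
  have hOo : IsOpen O := isOpen_setOfPred_eventually_nhds
  have hsub : okaY p (k + 1) a b ⊆ O := by
    intro z hz
    exact hK.eventually_forall_of_forall_eventually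
      (P := fun (z' : Fin n → ℂ) (q : P) => ∀ᶠ y in 𝓝 (z', q), DifferentiableAt ℂ f y)
      (fun q hq => (hf (z, q) ⟨hz, hq⟩).eventually_nhds)
  obtain ⟨δ, hδ, hth⟩ := (okaY_isCompact p hp (k + 1) a b).exists_cthickening_subset_open hOo hsub
  refine ⟨δ / 2, by positivity, fun a' b' ha hb hd => ?_⟩
  by_cases hne : ∃ w ∈ okaBox a' b', w ∈ okaY p (k + 1) a b
  · obtain ⟨w, hw, hwY⟩ := hne
    refine ⟨fun x => f (x.1, x.2.1), ?_, fun x _ => Eventually.of_forall fun y => rfl⟩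
    rintro x ⟨hx, hxK⟩
    have hxO : x.1 ∈ O := by
      refine hth (mem_cthickening_of_dist_le x.1 w δ _ hwY ?_)
      have := okaBox_dist a' b' (δ / 2) (by positivity) hd x.1 w hx.1 hw
      linarith
    have h1 : ∀ᶠ y in 𝓝 (x.1, x.2.1), DifferentiableAt ℂ f y := hxO.self_of_nhds _ hxK.1
    have hc : Tendsto (fun y : (Fin n → ℂ) × (P × ℂ) => (y.1, y.2.1)) (𝓝 x) (𝓝 (x.1, x.2.1)) :=
        Continuous.continuousAt (by fun_prop)
    filter_upwards [hc.eventually h1] with y hy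
    exact DifferentiableAt.comp (f := fun y : (Fin n → ℂ) × (P × ℂ) => (y.1, y.2.1)) y hy (by fun_prop)
  · refine ⟨fun _ => 0, fun x _ => Eventually.of_forall fun y => by fun_prop, ?_⟩
    rintro x ⟨hx, _⟩
    exact (hne ⟨x.1, hx.1, okaY_mono p _ ha hb hx⟩).elim

lemma oka_ext {n : ℕ} (p : ℕ → (Fin n → ℂ) → ℂ) (hp : ∀ i, Differentiable ℂ (p i)) (k : ℕ)
    (hs : OkaSplit p k) {P : Type} [NormedAddCommGroup P] [NormedSpace ℂ P] [ProperSpace P]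
    (K : Set P) (hK : IsCompact K) (f : (Fin n → ℂ) × P → ℂ) (a b : Fin n × Bool → ℝ)
    (hf : okaHol f (okaY p (k + 1) a b ×ˢ K)) : OkaExt p k K f a b := by
  obtain ⟨δ, hδ, hloc⟩ := oka_local p hp k K hK f a b hf
  have main : ∀ s : Finset (Fin n × Bool), ∀ a' b' : Fin n × Bool → ℝ, (∀ i, a i ≤ a' i) →
      (∀ i, b' i ≤ b i) → (∀ i ∉ s, b' i - a' i ≤ δ) → OkaExt p k K f a' b' := by
    intro s
    induction s using Finset.induction_on with
    | empty => exact fun a' b' ha hb h => hloc a' b' ha hb fun i => h i (by simp)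
    | insert i s his ih =>
      have step : ∀ m : ℕ, ∀ a' b' : Fin n × Bool → ℝ, (∀ i, a i ≤ a' i) →
          (∀ i, b' i ≤ b i) → (∀ j ∉ insert i s, b' j - a' j ≤ δ) → b' i - a' i ≤ (m + 1) * δ →
          OkaExt p k K f a' b' := by
        intro m
        induction m with
        | zero =>
          intro a' b' ha hb h hm
          refine ih a' b' ha hb fun j hj => ?_
          by_cases hji : j = i
          · subst hji; simpa using hm
          · exact h j (by simp [hji, hj])
        | succ m ihm =>
          intro a' b' ha hb h hm
          by_cases hsm : b' i - a' i ≤ (m + 1) * δ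
          · exact ihm a' b' ha hb h hsm
          have hm0 : (0:ℝ) ≤ m * δ := by positivity
          push Not at hsm
          push_cast at hm
          have hc1 : a' i ≤ a' i + δ := by linarith
          have hc2 : a' i + δ ≤ b' i := by nlinarith
          refine oka_glue p hp k hs K hK f a' b' i (a' i + δ) hc1 hc2 ?_ ?_
          · refine ih a' _ ha (fun j => (oka_update_le b' i _ hc2 j).trans (hb j)) fun j hj => ?_
            by_cases hji : j = i
            · subst hji; simp
            · rw [Function.update_of_ne hji]
              exact h j (by simp [hji, hj])
          · refine ihm _ b' (fun j => (ha j).trans (oka_le_update a' i _ hc1 j)) hb ?_ ?_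
            · intro j hj
              have hji : j ≠ i := by rintro rfl; simp at hj
              rw [Function.update_of_ne hji]
              exact h j hj
            · rw [Function.update_self]; linarith
      intro a' b' ha hb h
      obtain ⟨m, hm⟩ := exists_nat_ge ((b' i - a' i) / δ)
      refine step m a' b' ha hb h ?_
      rw [div_le_iff₀ hδ] at hm
      linarith
  exact main Finset.univ a b (fun _ => le_rfl) (fun _ => le_rfl) (by simp)

lemma oka_split {n : ℕ} (p : ℕ → (Fin n → ℂ) → ℂ) (hp : ∀ i, Differentiable ℂ (p i)) (k : ℕ) :
    OkaSplit p k := by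
  induction k with
  | zero => exact oka_split_zero p
  | succ k ih =>
    intro P _ _ _ K hK a b i c g hg
    obtain ⟨h, hh, he⟩ := oka_ext p hp k ih K hK g _ _ hg
    obtain ⟨h1, h2, hh1, hh2, hhs⟩ := ih (P × ℂ) (K ×ˢ closedBall (0:ℂ) 1)
      (hK.prod (isCompact_closedBall _ _)) a b i c h hh
    set A : (Fin n → ℂ) × P → (Fin n → ℂ) × (P × ℂ) := fun y => (y.1, (y.2, p k y.1)) with hA
    have hAd : Differentiable ℂ A := by
      have := hp k
      rw [hA]; fun_prop
    have hmem : ∀ (a b : Fin n × Bool → ℝ), ∀ x ∈ okaY p (k + 1) a b ×ˢ K,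
        A x ∈ okaY p k a b ×ˢ (K ×ˢ closedBall (0:ℂ) 1) := by
      rintro a b x ⟨hx, hxK⟩
      have := (okaY_succ p k).1 hx
      exact ⟨this.1, hxK, by simpa using this.2⟩
    refine ⟨fun y => h1 (A y), fun y => h2 (A y), ?_, ?_, ?_⟩
    · intro x hx
      filter_upwards [hAd.continuous.continuousAt.eventually (hh1 _ (hmem _ _ x hx))] with y hy
      exact DifferentiableAt.comp y hy hAd.differentiableAt
    · intro x hx
      filter_upwards [hAd.continuous.continuousAt.eventually (hh2 _ (hmem _ _ x hx))] with y hy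
      exact DifferentiableAt.comp y hy hAd.differentiableAt
    · intro x hx
      filter_upwards [hAd.continuous.continuousAt.eventually (hhs _ (hmem _ _ x hx)), he x hx]
        with y hy hy2
      rw [← hy2]
      exact hy

lemma oka_poly_differentiable {n : ℕ} (p : MvPolynomial (Fin n) ℂ) :
    Differentiable ℂ (fun z : Fin n → ℂ => MvPolynomial.eval z p) := by
  induction p using MvPolynomial.induction_on with
  | C a => simp
  | add p q hp hq =>
    simp only [map_add]
    exact hp.add hq
  | mul_X p i hp =>
    simp only [map_mul, MvPolynomial.eval_X]
    exact hp.mul (by fun_prop)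

/-- **Oka's extension theorem.** Let `p` be a polynomial, `μ z = (z, p z)`, `Y ⊆ ℂⁿ` a
compact polynomial polyhedron, `V = {(z, w) ∈ Y × ℂ : |w| ≤ 1}` and
`X = {z ∈ Y : |p z| ≤ 1}`. Every function `f` holomorphic on a neighborhood of `X` can
be written as `f z = h (μ z)` near `X`, where `h` is holomorphic on a neighborhood
of `V`. -/
theorem oka_extension
    {n : ℕ} (p : MvPolynomial (Fin n) ℂ)
    (Y : Set (Fin n → ℂ)) (hY : IsPolyPolyhedron Y)
    (V : Set ((Fin n → ℂ) × ℂ)) (hV : V = {x | x.1 ∈ Y ∧ ‖x.2‖ ≤ 1})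
    (X : Set (Fin n → ℂ)) (hX : X = {z ∈ Y | ‖MvPolynomial.eval z p‖ ≤ 1})
    (f : (Fin n → ℂ) → ℂ) (U : Set (Fin n → ℂ))
    (hU : IsOpen U) (hXU : X ⊆ U) (hf : DifferentiableOn ℂ f U) :
    ∃ (h : ((Fin n → ℂ) × ℂ) → ℂ) (U' : Set ((Fin n → ℂ) × ℂ)),
      IsOpen U' ∧ V ⊆ U' ∧ DifferentiableOn ℂ h U' ∧
      ∃ U'' : Set (Fin n → ℂ), IsOpen U'' ∧ X ⊆ U'' ∧
        ∀ z ∈ U'', f z = h (z, MvPolynomial.eval z p) := by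
  obtain ⟨hYc, k, P, hP⟩ := hY
  set q : ℕ → (Fin n → ℂ) → ℂ := fun i z =>
    if hi : i < k then MvPolynomial.eval z (P ⟨i, hi⟩) else MvPolynomial.eval z p with hq
  have hqd : ∀ i, Differentiable ℂ (q i) := by
    intro i
    by_cases hi : i < k
    · simpa only [hq, hi, dif_pos] using oka_poly_differentiable (P ⟨i, hi⟩)
    · simpa only [hq, hi, dif_neg, not_false_iff] using oka_poly_differentiable p
  have hqk : ∀ z, q k z = MvPolynomial.eval z p := by intro z; simp [hq]
  obtain ⟨R, hR⟩ := hYc.isBounded.exists_norm_le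
  have hYY : okaY q k (fun _ => -R) (fun _ => R) = Y := by
    ext z
    constructor
    · rintro ⟨_, hz⟩
      rw [hP]
      intro j
      have := hz j j.2
      simpa [hq] using this
    · intro hz
      refine ⟨fun i => ?_, fun i hi => ?_⟩
      · have h1 : ‖z i.1‖ ≤ R := (norm_le_pi_norm z i.1).trans (hR z hz)
        have h2 : |okaCoord i z| ≤ R := by
          unfold okaCoord
          split_ifs
          · exact (Complex.abs_re_le_norm _).trans h1
          · exact (Complex.abs_im_le_norm _).trans h1
        exact abs_le.1 h2
      · rw [hP] at hz
        have := hz ⟨i, hi⟩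
        simpa [hq, hi] using this
  have hXX : okaY q (k + 1) (fun _ => -R) (fun _ => R) = X := by
    ext z
    rw [okaY_succ, hYY, hX, hqk]
    rfl
  have hfH : okaHol (fun x : (Fin n → ℂ) × ℂ => f x.1)
      (okaY q (k + 1) (fun _ => -R) (fun _ => R) ×ˢ ({0} : Set ℂ)) := by
    rintro x ⟨hx, _⟩
    rw [hXX] at hx
    have hc : Tendsto (fun y : (Fin n → ℂ) × ℂ => y.1) (𝓝 x) (𝓝 x.1) := continuousAt_fst
    filter_upwards [hc.eventually (hU.mem_nhds (hXU hx))] with y hy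
    exact DifferentiableAt.comp (f := fun y : (Fin n → ℂ) × ℂ => y.1) y
      (hf.differentiableAt (hU.mem_nhds hy)) (by fun_prop)
  obtain ⟨h, hh, he⟩ := oka_ext q hqd k (oka_split q hqd k) ({0} : Set ℂ) isCompact_singleton
    (fun x => f x.1) _ _ hfH
  rw [hYY] at hh
  rw [hXX] at he
  set A : (Fin n → ℂ) × ℂ → (Fin n → ℂ) × (ℂ × ℂ) := fun x => (x.1, (0, x.2)) with hA
  have hAd : Differentiable ℂ A := by rw [hA]; fun_prop
  refine ⟨fun x => h (A x), {x | ∀ᶠ y in 𝓝 x, DifferentiableAt ℂ (fun x => h (A x)) y},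
    isOpen_setOfPred_eventually_nhds, ?_, ?_,
    {z | ∀ᶠ y in 𝓝 z, f y = h (A (y, MvPolynomial.eval y p))}, isOpen_setOfPred_eventually_nhds, ?_, ?_⟩
  · intro x hx
    rw [hV] at hx
    have hxA : A x ∈ Y ×ˢ (({0} : Set ℂ) ×ˢ closedBall (0:ℂ) 1) :=
      ⟨hx.1, rfl, by simpa using hx.2⟩
    show ∀ᶠ y in 𝓝 x, DifferentiableAt ℂ (fun x => h (A x)) y
    filter_upwards [hAd.continuous.continuousAt.eventually (hh _ hxA)] with y hy
    exact DifferentiableAt.comp y hy hAd.differentiableAt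
  · intro x hx
    exact (Eventually.self_of_nhds hx).differentiableWithinAt
  · intro z hz
    show ∀ᶠ y in 𝓝 z, f y = h (A (y, MvPolynomial.eval y p))
    have hc : Tendsto (fun y : Fin n → ℂ => (y, (0:ℂ))) (𝓝 z) (𝓝 (z, 0)) :=
      Continuous.continuousAt (by fun_prop)
    filter_upwards [hc.eventually (he (z, 0) ⟨hz, rfl⟩)] with y hy
    rw [hqk] at hy
    exact hy.symm
  · intro z hz
    have hz2 : ∀ᶠ y in 𝓝 z, f y = h (A (y, MvPolynomial.eval y p)) := hz
    exact hz2.self_of_nhds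
end

section
/- Let p₁,…,p_k ∈ ℂ[z₁,…,zₙ], let R > 0, let α : ℂⁿ → ℝ be an ℝ-linear functional, and let c ∈ ℝ. For ε > 0 set W_ε = {(z,w) ∈ ℂⁿ × ℂᵏ : |z_i| ≤ R+ε and |w_j| ≤ 1+ε for all i, j}, Z_ε = {(z,w) ∈ W_ε : p_j(z) = w_j for all j}, W′_ε = {(z,w) ∈ W_ε : α(z) ≤ c+ε}, W″_ε = {(z,w) ∈ W_ε : α(z) ≥ c−ε}, Z′_ε = Z_ε ∩ W′_ε and Z″_ε = Z_ε ∩ W″_ε. Then for all 0 < ε′ < ε the following holds: for every f′ ∈ B(W′_ε) and f″ ∈ B(W″_ε) with f′ = f″ on Z′_ε ∩ Z″_ε, there exists g ∈ B(W_{ε′}) such that g = f′ on Z′_{ε′} and g = f″ on Z″_{ε′}. -/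
/-- For a compact set `X ⊆ ℂᴵ`, `BXset X` is the Banach algebra `B(X)`: the closure in
`C(X, ℂ)` (with the supremum norm) of the set of restrictions to `X` of complex
polynomial functions. -/
noncomputable def BXset {ι : Type*} [Fintype ι] (X : Set (ι → ℂ)) : Set C(X, ℂ) :=
  closure (Set.range fun p : MvPolynomial ι ℂ =>
    (⟨fun z => MvPolynomial.eval (z : ι → ℂ) p,
      (MvPolynomial.continuous_eval p).comp continuous_subtype_val⟩ : C(X, ℂ)))

namespace Oka
open scoped ContDiff Topology
open Filter Set

/-- twice the Wirtinger derivative `∂/∂z̄ᵢ` -/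
noncomputable def db {ι : Type} [Fintype ι] [DecidableEq ι] (i : ι) (f : (ι → ℂ) → ℂ)
    (z : ι → ℂ) : ℂ :=
  fderiv ℝ f z (Pi.single i 1) + Complex.I * fderiv ℝ f z (Pi.single i Complex.I)

/-- smooth near `K` and holomorphic in the variables in `S` -/
def Hol {ι : Type} [Fintype ι] [DecidableEq ι] (S : Finset ι) (K : Set (ι → ℂ))
    (f : (ι → ℂ) → ℂ) : Prop :=
  ∀ᶠ z in 𝓝ˢ K, ContDiffAt ℝ ∞ f z ∧ ∀ i ∈ S, db i f z = 0

section basic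
variable {ι κ : Type} [Fintype ι] [DecidableEq ι] [Fintype κ] [DecidableEq κ]

lemma db_congr {i : ι} {f g : (ι → ℂ) → ℂ} {z : ι → ℂ} (h : f =ᶠ[𝓝 z] g) :
    db i f z = db i g z := by
  unfold db; rw [h.fderiv_eq]

lemma db_contDiffAt {i : ι} {f : (ι → ℂ) → ℂ} {z : ι → ℂ} (h : ContDiffAt ℝ ∞ f z) :
    ContDiffAt ℝ ∞ (db i f) z := by
  have h1 : ContDiffAt ℝ ∞ (fderiv ℝ f) z := h.fderiv_right (by simp)
  unfold db
  exact (h1.clm_apply contDiffAt_const).add (contDiffAt_const.mul (h1.clm_apply contDiffAt_const))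

lemma diffAt {f : (ι → ℂ) → ℂ} {z : ι → ℂ} (h : ContDiffAt ℝ ∞ f z) :
    DifferentiableAt ℝ f z := h.differentiableAt (by simp)

lemma db_add {i : ι} {f g : (ι → ℂ) → ℂ} {z : ι → ℂ} (hf : DifferentiableAt ℝ f z)
    (hg : DifferentiableAt ℝ g z) : db i (fun x => f x + g x) z = db i f z + db i g z := by
  unfold db; rw [fderiv_fun_add hf hg]; simp; ring

lemma db_sub {i : ι} {f g : (ι → ℂ) → ℂ} {z : ι → ℂ} (hf : DifferentiableAt ℝ f z)
    (hg : DifferentiableAt ℝ g z) : db i (fun x => f x - g x) z = db i f z - db i g z := by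
  unfold db; rw [fderiv_fun_sub hf hg]; simp; ring

lemma db_mul {i : ι} {f g : (ι → ℂ) → ℂ} {z : ι → ℂ} (hf : DifferentiableAt ℝ f z)
    (hg : DifferentiableAt ℝ g z) :
    db i (fun x => f x * g x) z = f z * db i g z + g z * db i f z := by
  unfold db; rw [fderiv_fun_mul hf hg]; simp; ring

lemma db_of_hol {i : ι} {f : (ι → ℂ) → ℂ} {z : ι → ℂ} (hf : DifferentiableAt ℂ f z) :
    db i f z = 0 := by
  unfold db
  rw [hf.fderiv_restrictScalars ℝ]
  have : (Pi.single i Complex.I : ι → ℂ) = Complex.I • Pi.single i 1 := by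
    rw [← Pi.single_smul]; simp
  rw [this]
  simp only [ContinuousLinearMap.coe_restrictScalars', map_smul, smul_eq_mul]
  rw [← mul_assoc, Complex.I_mul_I]; ring

lemma db_const {i : ι} (c : ℂ) (z : ι → ℂ) : db i (fun _ => c) z = 0 :=
  db_of_hol (differentiableAt_const c)

lemma db_comm {i l : ι} {f : (ι → ℂ) → ℂ} {z : ι → ℂ} (h : ContDiffAt ℝ ∞ f z) :
    db i (db l f) z = db l (db i f) z := by
  have h1 : ContDiffAt ℝ ∞ (fderiv ℝ f) z := h.fderiv_right (by simp)
  have hd : DifferentiableAt ℝ (fderiv ℝ f) z := h1.differentiableAt (by simp)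
  have hs : IsSymmSndFDerivAt ℝ f z := h.isSymmSndFDerivAt (by simp only [minSmoothness_of_isRCLikeNormedField]; exact WithTop.coe_le_coe.2 le_top)
  have key : ∀ (j : ι) (v : ι → ℂ), fderiv ℝ (db j f) z v =
      fderiv ℝ (fderiv ℝ f) z v (Pi.single j 1) +
        Complex.I * fderiv ℝ (fderiv ℝ f) z v (Pi.single j Complex.I) := by
    intro j v
    have e : ∀ u : ι → ℂ, HasFDerivAt (fun y => fderiv ℝ f y u)
        ((fderiv ℝ (fderiv ℝ f) z).flip u) z := by
      intro u
      exact hd.hasFDerivAt.clm_apply (hasFDerivAt_const u z) |>.congr_fderiv (by ext; simp)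
    have := (e (Pi.single j 1)).add ((e (Pi.single j Complex.I)).const_mul Complex.I)
    have h2 := this.fderiv
    have h3 : db j f = (fun y => fderiv ℝ f y (Pi.single j 1)) +
      (fun y => Complex.I * fderiv ℝ f y (Pi.single j Complex.I)) := by ext; simp [db]
    rw [h3, h2]; simp
  have hs' : ∀ u v, fderiv ℝ (fderiv ℝ f) z u v = fderiv ℝ (fderiv ℝ f) z v u := fun u v => hs u v
  rw [db, db, key, key, key, key, hs' (Pi.single i 1) (Pi.single l 1),
    hs' (Pi.single i 1) (Pi.single l Complex.I), hs' (Pi.single i Complex.I) (Pi.single l 1),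
    hs' (Pi.single i Complex.I) (Pi.single l Complex.I)]
  ring

lemma conj_lin (T : ℂ →L[ℝ] ℂ) (c : ℂ) :
    T c + Complex.I * T (Complex.I * c) =
      (starRingEnd ℂ) c * (T 1 + Complex.I * T Complex.I) := by
  have h1 : ∀ x y : ℝ, T (x + y * Complex.I) = x * T 1 + y * T Complex.I := by
    intro x y
    have : (x + y * Complex.I : ℂ) = x • (1:ℂ) + y • Complex.I := by simp
    rw [this, map_add, map_smul, map_smul]; simp
  obtain ⟨x, y⟩ := c
  have e1 : (⟨x, y⟩ : ℂ) = x + y * Complex.I := by apply Complex.ext <;> simp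
  have e2 : Complex.I * (⟨x, y⟩ : ℂ) = ((-y : ℝ) : ℂ) + x * Complex.I := by
    apply Complex.ext <;> simp
  rw [e2, h1, e1, h1]
  simp
  linear_combination (y * T Complex.I) * Complex.I_sq

lemma db_comp {i : ι} {f : (κ → ℂ) → ℂ} {Φ : (ι → ℂ) → (κ → ℂ)} {z : ι → ℂ}
    (hf : DifferentiableAt ℝ f (Φ z)) (hΦ : DifferentiableAt ℂ Φ z) :
    db i (fun x => f (Φ x)) z =
      ∑ l, (starRingEnd ℂ) (fderiv ℂ Φ z (Pi.single i 1) l) * db l f (Φ z) := by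
  have h1 : fderiv ℝ (fun x => f (Φ x)) z = (fderiv ℝ f (Φ z)).comp (fderiv ℝ Φ z) :=
    fderiv_comp z hf (hΦ.restrictScalars ℝ)
  have h3 : (Pi.single i Complex.I : ι → ℂ) = Complex.I • Pi.single i 1 := by
    rw [← Pi.single_smul]; simp
  unfold db
  rw [h1, hΦ.fderiv_restrictScalars ℝ, h3]
  simp only [ContinuousLinearMap.comp_apply, ContinuousLinearMap.coe_restrictScalars', map_smul]
  set v := fderiv ℂ Φ z (Pi.single i 1)
  set T := fderiv ℝ f (Φ z)
  have h4 : ∀ u : κ → ℂ, T u = ∑ l, T (Pi.single l (u l)) := by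
    intro u
    conv_lhs => rw [← Finset.univ_sum_single u]
    rw [map_sum]
  rw [h4 v, h4 (Complex.I • v), Finset.mul_sum, ← Finset.sum_add_distrib]
  refine Finset.sum_congr rfl fun l _ => ?_
  have := conj_lin (T.comp (ContinuousLinearMap.single ℝ (fun _ : κ => ℂ) l)) (v l)
  simpa using this

lemma hol_of_db {f : (ι → ℂ) → ℂ} {z : ι → ℂ} (hf : DifferentiableAt ℝ f z)
    (h : ∀ i, db i f z = 0) : DifferentiableAt ℂ f z := by
  rw [differentiableAt_iff_restrictScalars ℝ hf]
  set T := fderiv ℝ f z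
  have h4 : ∀ u : ι → ℂ, T u = ∑ l, T (Pi.single l (u l)) := by
    intro u
    conv_lhs => rw [← Finset.univ_sum_single u]
    rw [map_sum]
  have hI : ∀ u : ι → ℂ, T (Complex.I • u) = Complex.I * T u := by
    intro u
    rw [h4, h4 u, Finset.mul_sum]
    refine Finset.sum_congr rfl fun l _ => ?_
    have := conj_lin (T.comp (ContinuousLinearMap.single ℝ (fun _ : ι => ℂ) l)) (u l)
    have h0 := h l
    unfold db at h0
    simp only [ContinuousLinearMap.comp_apply, ContinuousLinearMap.single_apply] at this
    rw [h0, mul_zero] at this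
    simp only [Pi.smul_apply, smul_eq_mul]
    linear_combination (-Complex.I) * this + T (Pi.single l (Complex.I * u l)) * Complex.I_sq
  refine ⟨⟨⟨T.toLinearMap.toAddHom, ?_⟩, T.continuous⟩, ?_⟩
  · intro c u
    change T (c • u) = c • T u
    have : c • u = c.re • u + c.im • (Complex.I • u) := by
      ext l
      simp only [Pi.smul_apply, Pi.add_apply, smul_eq_mul, Complex.real_smul]
      conv_lhs => rw [← Complex.re_add_im c]
      ring
    rw [this, map_add, map_smul, map_smul, hI]
    simp only [smul_eq_mul, Complex.real_smul]
    conv_rhs => rw [← Complex.re_add_im c]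
    ring
  · ext; rfl

end basic
end Oka

namespace Oka
open scoped ContDiff Topology Real
open Filter Set MeasureTheory

lemma pompeiu_zero (ψ : ℂ → ℂ) (hψ : ContDiff ℝ 1 ψ) (hc : HasCompactSupport ψ) :
    ∫ ζ : ℂ, ζ⁻¹ * (fderiv ℝ ψ ζ 1 + Complex.I * fderiv ℝ ψ ζ Complex.I) = -(2 * π * ψ 0) := by
  obtain ⟨M, hM0, hM⟩ : ∃ M > 0, ∀ ζ : ℂ, M ≤ ‖ζ‖ → ψ ζ = 0 := by
    obtain ⟨M, hM0, hM⟩ := hc.exists_pos_le_norm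
    exact ⟨M, hM0, hM⟩
  have hM' : ∀ ζ : ℂ, M < ‖ζ‖ → fderiv ℝ ψ ζ = 0 := by
    intro ζ hζ
    have : ψ =ᶠ[𝓝 ζ] fun _ => 0 := by
      filter_upwards [(isOpen_lt continuous_const continuous_norm).mem_nhds hζ] with x hx
      exact hM x (le_of_lt hx)
    rw [this.fderiv_eq]; simp
  set e : ℝ → ℂ := fun θ => Real.cos θ + Real.sin θ * Complex.I with he
  have hec : Continuous e := by fun_prop
  have hen : ∀ θ, ‖e θ‖ = 1 := by
    intro θ
    simp only [he, Complex.ofReal_cos, Complex.ofReal_sin]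
    rw [← Complex.exp_mul_I, Complex.norm_exp_ofReal_mul_I]
  have hD : Continuous (fderiv ℝ ψ) := hψ.continuous_fderiv (by simp)
  set u : ℝ × ℝ → ℂ := fun q => fderiv ℝ ψ (q.1 * e q.2) (e q.2) with hu
  set v : ℝ × ℝ → ℂ := fun q => Complex.I * fderiv ℝ ψ (q.1 * e q.2) (Complex.I * e q.2) with hv
  have huc : Continuous u := by
    apply Continuous.clm_apply
    · exact hD.comp (by fun_prop)
    · fun_prop
  have hvc : Continuous v := by
    apply continuous_const.mul
    apply Continuous.clm_apply
    · exact hD.comp (by fun_prop)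
    · fun_prop
  have hint : ∀ w : ℝ × ℝ → ℂ, Continuous w → (∀ q, M < q.1 → w q = 0) →
      IntegrableOn w (Ioi (0:ℝ) ×ˢ Ioo (-π) π) := by
    intro w hw h0
    have h1 : IntegrableOn w (Icc (0:ℝ) M ×ˢ Icc (-π) π) :=
      hw.continuousOn.integrableOn_compact (isCompact_Icc.prod isCompact_Icc)
    refine h1.of_forall_sdiff_eq_zero (measurableSet_Ioi.prod measurableSet_Ioo) ?_
    rintro ⟨r, θ⟩ ⟨⟨h2, h3⟩, h4⟩
    apply h0
    by_contra h5
    exact h4 ⟨⟨le_of_lt h2, not_lt.1 h5⟩, ⟨h3.1.le, h3.2.le⟩⟩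
  have hnorm : ∀ q : ℝ × ℝ, M < q.1 → M < ‖(q.1 : ℂ) * e q.2‖ := by
    intro q hq
    rw [norm_mul, hen, mul_one, Complex.norm_real]
    exact hq.trans_le (le_abs_self _)
  have hui := hint u huc (fun q hq => by simp [hu, hM' _ (hnorm q hq)])
  have hvi := hint v hvc (fun q hq => by simp [hv, hM' _ (hnorm q hq)])
  rw [← Complex.integral_comp_polarCoord_symm]
  have h1 : ∫ q in polarCoord.target, q.1 • ((Complex.polarCoord.symm q)⁻¹ *
      (fderiv ℝ ψ (Complex.polarCoord.symm q) 1 +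
        Complex.I * fderiv ℝ ψ (Complex.polarCoord.symm q) Complex.I)) =
      ∫ q in Ioi (0:ℝ) ×ˢ Ioo (-π) π, (u q + v q) := by
    rw [polarCoord_target]
    refine setIntegral_congr_fun (measurableSet_Ioi.prod measurableSet_Ioo) ?_
    rintro ⟨r, θ⟩ ⟨hr, -⟩
    have hr' : (r : ℂ) ≠ 0 := by exact_mod_cast (ne_of_gt hr)
    have h2 := conj_lin (fderiv ℝ ψ (r * e θ)) (e θ)
    have h3 : (starRingEnd ℂ) (e θ) = (e θ)⁻¹ := by
      rw [Complex.inv_def, Complex.normSq_eq_norm_sq, hen]; simp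
    simp only [Complex.polarCoord_symm_apply, hu, hv]
    rw [h2, h3, mul_inv, Complex.real_smul, ← mul_assoc, ← mul_assoc, mul_inv_cancel₀ hr', one_mul]
  rw [h1, integral_add hui hvi]
  have hU : ∫ q in Ioi (0:ℝ) ×ˢ Ioo (-π) π, u q = -(2 * π * ψ 0) := by
    rw [Measure.volume_eq_prod, ← Measure.prod_restrict, integral_prod_symm]
    · have : ∀ θ : ℝ, ∫ r in Ioi (0:ℝ), u (r, θ) = - ψ 0 := by
        intro θ
        have := integral_Ioi_of_hasDerivAt_of_tendsto' (a := 0) (m := 0)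
          (f := fun r : ℝ => ψ (r * e θ)) (f' := fun r => u (r, θ)) ?_ ?_ ?_
        · simpa using this
        · intro r _
          have h5 : HasDerivAt (fun r : ℝ => (r : ℂ) * e θ) (e θ) r := by
            simpa using (Complex.ofRealCLM.hasDerivAt (x := r)).mul_const (e θ)
          exact ((hψ.differentiable (by simp)) _).hasFDerivAt.comp_hasDerivAt r h5
        · have h1 : IntegrableOn (fun r => u (r, θ)) (Icc (0:ℝ) M) :=
            (huc.comp (by fun_prop)).continuousOn.integrableOn_compact isCompact_Icc
          refine h1.of_forall_sdiff_eq_zero measurableSet_Ioi ?_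
          rintro r ⟨h2, h4⟩
          have : M < r := by
            by_contra h5
            exact h4 ⟨le_of_lt h2, not_lt.1 h5⟩
          simp [hu, hM' _ (hnorm (r, θ) this)]
        · apply tendsto_const_nhds.congr'
          filter_upwards [eventually_ge_atTop M] with r hr
          rw [hM]
          rw [norm_mul, hen, mul_one, Complex.norm_real]
          exact hr.trans (le_abs_self _)
      simp_rw [this]
      simp [Real.pi_pos.le]
      left; ring
    · rw [Measure.prod_restrict]; exact hui
  have hV : ∫ q in Ioi (0:ℝ) ×ˢ Ioo (-π) π, v q = 0 := by
    rw [Measure.volume_eq_prod, ← Measure.prod_restrict, integral_prod]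
    · refine integral_eq_zero_of_ae ?_
      rw [EventuallyEq, ae_restrict_iff' measurableSet_Ioi]
      refine Eventually.of_forall fun r hr => ?_
      have hr' : (r : ℂ) ≠ 0 := by exact_mod_cast (ne_of_gt hr)
      have hd : ∀ θ : ℝ, HasDerivAt (fun θ : ℝ => Complex.I * (r : ℂ)⁻¹ * ψ (r * e θ)) (v (r, θ)) θ := by
        intro θ
        have h4 : HasDerivAt e (Complex.I * e θ) θ := by
          have h6 := ((Real.hasDerivAt_cos θ).ofReal_comp).add
            (((Real.hasDerivAt_sin θ).ofReal_comp).mul_const Complex.I)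
          refine h6.congr_deriv ?_
          simp only [he]
          push_cast
          linear_combination (-Complex.sin θ) * Complex.I_sq
        have h5 : HasDerivAt (fun θ : ℝ => (r : ℂ) * e θ) (r • (Complex.I * e θ)) θ := by
          simpa using h4.const_mul (r : ℂ)
        have h7 := ((hψ.differentiable (by simp)) _).hasFDerivAt.comp_hasDerivAt θ h5
        have h8 := h7.const_mul (Complex.I * (r : ℂ)⁻¹)
        refine h8.congr_deriv ?_
        have h9 : fderiv ℝ ψ (r * e θ) (r • (Complex.I * e θ)) =
          (r : ℂ) * fderiv ℝ ψ (r * e θ) (Complex.I * e θ) := by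
          rw [ContinuousLinearMap.map_smul, Complex.real_smul]
        rw [h9]
        simp only [hv]
        field_simp
      rw [← integral_Ioc_eq_integral_Ioo, ← intervalIntegral.integral_of_le (by linarith [Real.pi_pos]),
        intervalIntegral.integral_eq_sub_of_hasDerivAt (fun θ _ => hd θ)
          ((hvc.comp (by fun_prop)).intervalIntegrable _ _)]
      simp [he]
    · rw [Measure.prod_restrict]; exact hvi
  rw [hU, hV, add_zero]

lemma pompeiu (φ : ℂ → ℂ) (hφ : ContDiff ℝ 1 φ) (hc : HasCompactSupport φ) (z : ℂ) :
    ∫ ζ : ℂ, ζ⁻¹ * (fderiv ℝ φ (z - ζ) 1 + Complex.I * fderiv ℝ φ (z - ζ) Complex.I)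
      = 2 * π * φ z := by
  have hψ : ContDiff ℝ 1 (fun ζ => φ (z - ζ)) := hφ.comp (contDiff_const.sub contDiff_id)
  have hcψ : HasCompactSupport (fun ζ => φ (z - ζ)) :=
    hc.comp_homeomorph (Homeomorph.subLeft z)
  have := pompeiu_zero _ hψ hcψ
  have h2 : ∀ ζ, fderiv ℝ (fun ζ => φ (z - ζ)) ζ = - fderiv ℝ φ (z - ζ) := by
    intro ζ
    have h3 : HasFDerivAt (fun ζ : ℂ => z - ζ) (-ContinuousLinearMap.id ℝ ℂ) ζ := by
      simpa using (hasFDerivAt_id (𝕜 := ℝ) ζ).const_sub z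
    have h4 := ((hφ.differentiable (by simp)) (z - ζ)).hasFDerivAt.comp ζ h3
    rw [show (fun ζ => φ (z - ζ)) = φ ∘ (fun ζ => z - ζ) from rfl, h4.fderiv]
    ext <;> simp
  simp only [h2, neg_apply, sub_zero] at this
  rw [← neg_inj, ← this, ← integral_neg]
  congr 1; ext ζ; ring

lemma locInt_inv : LocallyIntegrable (fun ζ : ℂ => ζ⁻¹) := by
  refine locallyIntegrable_of_norm_le_rpow (C := 1) (α := 1) ?_ ?_ ?_ ?_
  · simp
  · simp
  · refine Eventually.of_forall fun x => ?_
    rw [norm_inv, Real.rpow_neg (norm_nonneg _), Real.rpow_one, one_mul]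
  · exact measurable_inv.aestronglyMeasurable
end Oka

namespace Oka
open scoped ContDiff Topology Real Convolution
open Filter Set MeasureTheory

section poly
set_option linter.unusedSectionVars false
variable {ι : Type} [Fintype ι] [DecidableEq ι]

/-- closed polydisc -/
def PD (ρ : ι → ℝ) : Set (ι → ℂ) := {z | ∀ l, ‖z l‖ ≤ ρ l}

lemma PD_compact (ρ : ι → ℝ) : IsCompact (PD ρ) := by
  have : PD ρ = Set.univ.pi fun l => Metric.closedBall (0:ℂ) (ρ l) := by
    ext z; simp [PD]
  rw [this]
  exact isCompact_univ_pi fun l => isCompact_closedBall _ _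

lemma PD_open (ρ : ι → ℝ) : IsOpen {z : ι → ℂ | ∀ l, ‖z l‖ < ρ l} := by
  have : {z : ι → ℂ | ∀ l, ‖z l‖ < ρ l} = ⋂ l, {z | ‖z l‖ < ρ l} := by ext; simp
  rw [this]
  exact isOpen_iInter_of_finite fun l => isOpen_lt (by fun_prop) continuous_const

lemma PD_nhds {ρ : ι → ℝ} {δ : ℝ} (hδ : 0 < δ) :
    ∀ᶠ z in 𝓝ˢ (PD ρ), ∀ l, ‖z l‖ < ρ l + δ := by
  have h := ((PD_open (fun l => ρ l + δ)).mem_nhdsSet (t := PD ρ)).2 ?_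
  · exact h
  · intro z hz l
    have := hz l
    linarith

lemma PD_exists {ρ : ι → ℝ} (hρ : ∀ l, 0 < ρ l) {P : (ι → ℂ) → Prop}
    (h : ∀ᶠ z in 𝓝ˢ (PD ρ), P z) : ∃ δ > 0, ∀ z : ι → ℂ, (∀ l, ‖z l‖ < ρ l + δ) → P z := by
  rw [eventually_nhdsSet_iff_exists] at h
  obtain ⟨U, hU, hKU, hP⟩ := h
  obtain ⟨δ, hδ, hsub⟩ := (PD_compact ρ).exists_thickening_subset_open hU hKU
  refine ⟨δ, hδ, fun z hz => hP z (hsub ?_)⟩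
  rw [Metric.mem_thickening_iff]
  refine ⟨fun l => ((min 1 (ρ l / ‖z l‖) : ℝ) : ℂ) * z l, ?_, ?_⟩
  · intro l
    rw [norm_mul, Complex.norm_real, Real.norm_of_nonneg (by have := hρ l; positivity)]
    rcases eq_or_ne (z l) 0 with h0 | h0
    · simp [h0, (hρ l).le]
    · calc _ ≤ ρ l / ‖z l‖ * ‖z l‖ := by gcongr; exact min_le_right _ _
        _ = ρ l := by field_simp
  · rw [dist_pi_lt_iff hδ]
    intro l
    rw [dist_eq_norm]
    have : z l - ((min 1 (ρ l / ‖z l‖) : ℝ) : ℂ) * z l = ((1 - min 1 (ρ l / ‖z l‖) : ℝ) : ℂ) * z l := by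
      push_cast; ring
    rw [this, norm_mul, Complex.norm_real,
      Real.norm_of_nonneg (by have := min_le_left 1 (ρ l / ‖z l‖); linarith)]
    rcases le_total ‖z l‖ (ρ l) with h1 | h1
    · rcases eq_or_ne (z l) 0 with h0 | h0
      · simp [h0, hδ]
      · rw [min_eq_left]
        · simpa using hδ
        · rw [le_div_iff₀ (by positivity)]; simpa using h1
    · have hz0 : 0 < ‖z l‖ := (hρ l).trans_le h1
      rw [min_eq_right (by rw [div_le_iff₀ hz0]; simpa using h1), sub_mul, div_mul_cancel₀ _ hz0.ne']
      have := hz l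
      linarith

lemma fderiv_coord {φ : ℂ → ℂ} {i : ι} {z : ι → ℂ} (h : DifferentiableAt ℝ φ (z i)) (v : ι → ℂ) :
    fderiv ℝ (fun z : ι → ℂ => φ (z i)) z v = fderiv ℝ φ (z i) (v i) := by
  have h1 : HasFDerivAt (fun z : ι → ℂ => z i)
    (ContinuousLinearMap.proj (R := ℝ) (φ := fun _ : ι => ℂ) i) z := hasFDerivAt_apply i z
  have := (h.hasFDerivAt.comp z h1).fderiv
  rw [show (fun z : ι → ℂ => φ (z i)) = φ ∘ (fun z => z i) from rfl, this]
  simp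

lemma solve_base (ρ : ι → ℝ) (hρ : ∀ l, 0 < ρ l) (S : Finset ι) (i : ι) (hi : i ∉ S)
    (A : (ι → ℂ) → ℂ) (hA : Hol S (PD ρ) A) :
    ∃ B, Hol S (PD ρ) B ∧ ∀ᶠ z in 𝓝ˢ (PD ρ), db i B z = A z := by
  obtain ⟨δ, hδ, hA⟩ := PD_exists hρ hA
  have hρi := hρ i
  let η : ContDiffBump (0:ℂ) := ⟨ρ i + δ / 3, ρ i + 2 * δ / 3, by linarith, by linarith⟩
  have hη0 : ∀ x : ℂ, ρ i + 2 * δ / 3 ≤ ‖x‖ → η x = 0 := fun x hx =>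
    η.zero_of_le_dist (by simpa using hx)
  have hη1 : ∀ x : ℂ, ‖x‖ ≤ ρ i + δ / 3 → η x = 1 := fun x hx =>
    η.one_of_mem_closedBall (by simpa using hx)
  have hηs : ContDiff ℝ ∞ (fun x => ((η x : ℝ) : ℂ)) := Complex.ofRealCLM.contDiff.comp η.contDiff
  set s : Set (ι → ℂ) := {z | ∀ l, ‖z l‖ < ρ l + δ} with hs
  have hso : IsOpen s := PD_open (fun l => ρ l + δ)
  set Ω : Set (ι → ℂ) := {z | ∀ l, l ≠ i → ‖z l‖ < ρ l + δ} with hΩ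
  set h : (ι → ℂ) → ℂ := fun z => (η (z i) : ℂ) * A z with hh
  have hhz : ∀ z : ι → ℂ, ρ i + 2 * δ / 3 < ‖z i‖ → h =ᶠ[𝓝 z] fun _ => 0 := by
    intro z hz
    have : ∀ᶠ y : ι → ℂ in 𝓝 z, ρ i + 2 * δ / 3 < ‖y i‖ :=
      (isOpen_lt continuous_const (by fun_prop)).mem_nhds hz
    filter_upwards [this] with y hy
    simp [hh, hη0 _ hy.le]
  have hcase : ∀ z ∈ Ω, z ∈ s ∨ ρ i + 2 * δ / 3 < ‖z i‖ := by
    intro z hz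
    by_cases h1 : ‖z i‖ < ρ i + δ
    · left
      intro l
      by_cases hl : l = i
      · subst hl; exact h1
      · exact hz l hl
    · right; linarith
  have hηz : ∀ z : ι → ℂ, ContDiffAt ℝ ∞ (fun z : ι → ℂ => ((η (z i) : ℝ) : ℂ)) z := fun z =>
    (hηs.comp (contDiff_apply ℝ ℂ i)).contDiffAt
  have hsm : ∀ z ∈ Ω, ContDiffAt ℝ ∞ h z := by
    intro z hz
    rcases hcase z hz with h1 | h1
    · exact (hηz z).mul (hA z h1).1
    · exact contDiffAt_const.congr_of_eventuallyEq (hhz z h1)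
  have hdbh : ∀ z ∈ Ω, ∀ l ∈ S, db l h z = 0 := by
    intro z hz l hl
    rcases hcase z hz with h1 | h1
    · rw [hh, db_mul (diffAt (hηz z)) (diffAt (hA z h1).1), (hA z h1).2 l hl]
      have hne : i ≠ l := fun h => hi (h ▸ hl)
      have : db l (fun z : ι → ℂ => ((η (z i) : ℝ) : ℂ)) z = 0 := by
        unfold db
        have hd := (hηs.differentiable (by simp)) (z i)
        rw [fderiv_coord (φ := fun x => ((η x : ℝ) : ℂ)) hd,
          fderiv_coord (φ := fun x => ((η x : ℝ) : ℂ)) hd]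
        simp [Pi.single_eq_of_ne hne]
      rw [this]; simp
    · rw [db_congr (hhz z h1), db_const]
  have hsΩ : ∀ z ∈ s, ∀ x : ℂ, z + Pi.single i x ∈ Ω := by
    intro z hz x l hl
    simp [Pi.single_eq_of_ne hl, hz l]
  let g : (ι → ℂ) → ℂ → ℂ := fun p x => h (p + Pi.single i x)
  have hsingle : ContDiff ℝ ∞ (fun x : ℂ => (Pi.single i x : ι → ℂ)) :=
    (ContinuousLinearMap.single ℝ (fun _ : ι => ℂ) i).contDiff
  have hgs : ∀ q : (ι → ℂ) × ℂ, q.1 ∈ s → ContDiffAt ℝ ∞ ↿g q := by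
    intro q hq
    have h1 : ContDiff ℝ ∞ (fun q : (ι → ℂ) × ℂ => q.1 + (Pi.single i q.2 : ι → ℂ)) :=
      contDiff_fst.add (hsingle.comp contDiff_snd)
    exact ContDiffAt.comp (g := h) (f := fun q : (ι → ℂ) × ℂ => q.1 + (Pi.single i q.2 : ι → ℂ)) q
      (hsm _ (hsΩ _ hq q.2)) h1.contDiffAt
  have hg : ContDiffOn ℝ ∞ ↿g (s ×ˢ univ) := fun q hq => (hgs q hq.1).contDiffWithinAt
  set k : Set ℂ := Metric.closedBall 0 (2 * (ρ i + δ)) with hk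
  have hkc : IsCompact k := isCompact_closedBall _ _
  have hgk' : ∀ p, ∀ x, p ∈ s → x ∉ k → ρ i + 2 * δ / 3 < ‖(p + (Pi.single i x : ι → ℂ)) i‖ := by
    intro p x hp hx
    have h1 : 2 * (ρ i + δ) < ‖x‖ := by simpa [hk] using hx
    have h2 := hp i
    have h3 : ‖x‖ ≤ ‖p i + x‖ + ‖p i‖ := by
      calc ‖x‖ = ‖(p i + x) - p i‖ := by congr 1; ring
        _ ≤ _ := norm_sub_le _ _
    simp only [Pi.add_apply, Pi.single_eq_same]
    linarith
  have hgk : ∀ p, ∀ x, p ∈ s → x ∉ k → g p x = 0 := by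
    intro p x hp hx
    exact (hhz _ (hgk' p x hp hx)).self_of_nhds
  set f : ℂ → ℂ := fun ζ => ζ⁻¹ with hf
  set C : (ι → ℂ) → ℂ := fun z => (f ⋆[ContinuousLinearMap.mul ℝ ℂ, volume] g z) 0 with hC
  have hCs : ContDiffOn ℝ ∞ C s :=
    contDiffOn_convolution_right_with_param_comp (n := ⊤) (ContinuousLinearMap.mul ℝ ℂ)
      (v := fun _ => (0:ℂ)) contDiffOn_const hso hkc hgk locInt_inv hg
  have hCat : ∀ z ∈ s, ContDiffAt ℝ ∞ C z := fun z hz => hCs.contDiffAt (hso.mem_nhds hz)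
  have hcont : ∀ z ∈ s, ∀ v : ι → ℂ, Continuous (fun x : ℂ => fderiv ℝ h (z + Pi.single i x) v) := by
    intro z hz v
    rw [continuous_iff_continuousAt]
    intro x
    have h1 : ContDiffAt ℝ ∞ (fderiv ℝ h) (z + Pi.single i x) :=
      (hsm _ (hsΩ _ hz x)).fderiv_right (by simp)
    have h2 : ContinuousAt (fun x : ℂ => z + (Pi.single i x : ι → ℂ)) x :=
      (continuous_const.add hsingle.continuous).continuousAt
    exact (ContinuousAt.comp (f := fun x : ℂ => z + (Pi.single i x : ι → ℂ)) (g := fderiv ℝ h)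
      h1.continuousAt h2).clm_apply continuousAt_const
  have hsupp : ∀ z ∈ s, ∀ x, x ∉ k → fderiv ℝ h (z + Pi.single i x) = 0 := by
    intro z hz x hx
    rw [(hhz _ (hgk' z x hz hx)).fderiv_eq]; simp
  have hderiv : ∀ z ∈ s, ∀ v, fderiv ℝ C z v = ∫ ζ, ζ⁻¹ * fderiv ℝ h (z + Pi.single i (-ζ)) v := by
    intro z hz v
    have h1 := hasFDerivAt_convolution_right_with_param (ContinuousLinearMap.mul ℝ ℂ) hso hkc hgk
      locInt_inv (hg.of_le (by simp)) (z, 0) hz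
    have h2 : HasFDerivAt (fun z : ι → ℂ => (z, (0:ℂ))) (ContinuousLinearMap.inl ℝ (ι → ℂ) ℂ) z :=
      hasFDerivAt_prodMk_left z 0
    have h3 := (h1.comp z h2).fderiv
    have h4 : C = (fun q : (ι → ℂ) × ℂ => (f ⋆[ContinuousLinearMap.mul ℝ ℂ, volume] g q.1) q.2) ∘
      (fun z : ι → ℂ => (z, (0:ℂ))) := rfl
    have hgd : ∀ x, fderiv ℝ ↿g (z, x) = (fderiv ℝ h (z + Pi.single i x)).comp
        (ContinuousLinearMap.fst ℝ (ι → ℂ) ℂ +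
          (ContinuousLinearMap.single ℝ (fun _ : ι => ℂ) i).comp (ContinuousLinearMap.snd ℝ (ι → ℂ) ℂ)) := by
      intro x
      have e1 := (diffAt (hsm _ (hsΩ _ hz x))).hasFDerivAt
      have e2 := (ContinuousLinearMap.fst ℝ (ι → ℂ) ℂ +
          (ContinuousLinearMap.single ℝ (fun _ : ι => ℂ) i).comp
            (ContinuousLinearMap.snd ℝ (ι → ℂ) ℂ)).hasFDerivAt (x := (z, x))
      exact (HasFDerivAt.comp (z, x) (g := h) (f := fun q : (ι → ℂ) × ℂ => q.1 + (Pi.single i q.2 : ι → ℂ)) e1 e2).fderiv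
    rw [h4, h3]
    rw [ContinuousLinearMap.comp_apply, convolution_precompR_apply]
    · simp only [convolution, zero_sub, ContinuousLinearMap.mul_apply', hgd]
      simp [hf]
    · exact locInt_inv
    · refine HasCompactSupport.intro hkc fun x hx => ?_
      rw [hgd, hsupp z hz x hx]; simp
    · rw [continuous_iff_continuousAt]
      intro x
      have e1 : ContDiffAt ℝ ∞ (fderiv ℝ ↿g) (z, x) := (hgs (z, x) hz).fderiv_right (by simp)
      exact ContinuousAt.comp (f := fun x : ℂ => (z, x)) e1.continuousAt (by fun_prop)
  have hinteg : ∀ z ∈ s, ∀ v, Integrable (fun ζ : ℂ => ζ⁻¹ * fderiv ℝ h (z + Pi.single i (-ζ)) v) := by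
    intro z hz v
    have h1 := LocallyIntegrable.integrable_smul_right_of_hasCompactSupport locInt_inv
      (g := fun ζ : ℂ => fderiv ℝ h (z + Pi.single i (-ζ)) v)
      (by have := hcont z hz v; exact this.comp (continuous_neg (G := ℂ))) ?_
    · simpa using h1
    · refine HasCompactSupport.intro (hkc.neg) fun x hx => ?_
      rw [hsupp z hz (-x) (by simpa using hx)]; simp
  have hdbC : ∀ z ∈ s, ∀ l, db l C z = ∫ ζ, ζ⁻¹ * db l h (z + Pi.single i (-ζ)) := by
    intro z hz l
    unfold db
    rw [hderiv z hz, hderiv z hz, ← integral_const_mul, ← integral_add (hinteg z hz _)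
      ((hinteg z hz _).const_mul _)]
    congr 1; ext ζ; ring
  have hdbi : ∀ z ∈ s, db i C z = 2 * π * h z := by
    intro z hz
    set φ : ℂ → ℂ := fun x => h (z + Pi.single i (x - z i)) with hφ
    have haff : ContDiff ℝ ∞ (fun x : ℂ => z + (Pi.single i (x - z i) : ι → ℂ)) :=
      contDiff_const.add (hsingle.comp (contDiff_id.sub contDiff_const))
    have hφs : ContDiff ℝ ∞ φ := by
      rw [contDiff_iff_contDiffAt]
      intro x
      exact (hsm _ (hsΩ _ hz _)).comp x haff.contDiffAt
    have hφc : HasCompactSupport φ := by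
      refine HasCompactSupport.intro (isCompact_closedBall (0:ℂ) (ρ i + 2 * δ / 3)) fun x hx => ?_
      refine (hhz _ ?_).self_of_nhds
      simpa using hx
    have hφd : ∀ x c, fderiv ℝ φ x c = fderiv ℝ h (z + Pi.single i (x - z i)) (Pi.single i c) := by
      intro x c
      have e1 := (diffAt (hsm _ (hsΩ _ hz (x - z i)))).hasFDerivAt
      have e2 : HasFDerivAt (fun x : ℂ => z + (Pi.single i (x - z i) : ι → ℂ))
        (ContinuousLinearMap.single ℝ (fun _ : ι => ℂ) i) x := by
        have := ((ContinuousLinearMap.single ℝ (fun _ : ι => ℂ) i).hasFDerivAt (x := x - z i)).comp x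
          ((hasFDerivAt_id (𝕜 := ℝ) x).sub_const (z i))
        exact this.const_add z
      have e3 := (e1.comp x e2).fderiv
      rw [hφ, show (fun x => h (z + Pi.single i (x - z i))) =
        h ∘ (fun x => z + (Pi.single i (x - z i) : ι → ℂ)) from rfl, e3]
      simp
    have := pompeiu φ (hφs.of_le (by simp)) hφc (z i)
    rw [hdbC z hz i]
    have h5 : φ (z i) = h z := by simp [hφ]
    rw [← h5, ← this]
    congr 1; ext ζ
    rw [hφd, hφd]
    unfold db
    simp
  refine ⟨fun z => (2 * π : ℂ)⁻¹ * C z, ?_, ?_⟩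
  · filter_upwards [PD_nhds hδ] with z hz
    refine ⟨contDiffAt_const.mul (hCat z hz), fun l hl => ?_⟩
    rw [db_mul (differentiableAt_const _) (diffAt (hCat z hz)), db_const, hdbC z hz]
    have : ∀ ζ : ℂ, db l h (z + Pi.single i (-ζ)) = 0 := fun ζ => hdbh _ (hsΩ _ hz _) l hl
    simp [this]
  · filter_upwards [PD_nhds hδ, PD_nhds (ρ := ρ) (show 0 < δ / 3 by linarith)] with z hz hz'
    rw [db_mul (differentiableAt_const _) (diffAt (hCat z hz)), db_const, hdbi z hz]
    have h6 : η (z i) = 1 := hη1 _ (hz' i).le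
    have h7 : (π : ℂ) ≠ 0 := by exact_mod_cast Real.pi_ne_zero
    simp only [hh, h6]
    field_simp
    simp

end poly
end Oka

namespace Oka
open scoped ContDiff Topology Real
open Filter Set MeasureTheory

section lift
set_option linter.unusedSectionVars false
variable {ι : Type} [Fintype ι] [DecidableEq ι]

/-- forget the extra coordinate -/
def res (x : Option ι → ℂ) : ι → ℂ := fun i => x (some i)

/-- graph embedding -/
def emb (q : (ι → ℂ) → ℂ) (z : ι → ℂ) : Option ι → ℂ := fun o => o.elim (q z) z

/-- restriction as a continuous linear map -/
noncomputable def resL : (Option ι → ℂ) →L[ℂ] (ι → ℂ) :=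
  ContinuousLinearMap.pi fun i => ContinuousLinearMap.proj (some i)

lemma resL_eq : (resL : (Option ι → ℂ) → (ι → ℂ)) = res := by
  ext x i; simp [resL, res]

lemma res_contDiff : ContDiff ℂ ∞ (res : (Option ι → ℂ) → (ι → ℂ)) :=
  contDiff_pi.2 fun i => contDiff_apply ℂ ℂ (some i)

lemma res_fderiv (x v : Option ι → ℂ) : fderiv ℂ res x v = res v := by
  rw [← resL_eq, ContinuousLinearMap.fderiv]

@[simp] lemma res_emb (q : (ι → ℂ) → ℂ) (z : ι → ℂ) : res (emb q z) = z := rfl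
@[simp] lemma emb_none (q : (ι → ℂ) → ℂ) (z : ι → ℂ) : emb q z none = q z := rfl

lemma emb_contDiff {q : (ι → ℂ) → ℂ} (hq : ContDiff ℂ ∞ q) : ContDiff ℂ ∞ (emb q) := by
  rw [contDiff_pi]
  rintro (_ | i)
  · exact hq
  · exact contDiff_apply ℂ ℂ i

lemma db_res_some {f : (ι → ℂ) → ℂ} {x : Option ι → ℂ} (i : ι)
    (hf : DifferentiableAt ℝ f (res x)) :
    db (some i) (fun x => f (res x)) x = db i f (res x) := by
  rw [db_comp hf (res_contDiff.differentiable (by simp) x), res_fderiv]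
  rw [Finset.sum_eq_single i]
  · simp [res]
  · intro l _ hl
    simp [res, Pi.single_apply, hl]
  · simp

lemma db_res_none {f : (ι → ℂ) → ℂ} {x : Option ι → ℂ}
    (hf : DifferentiableAt ℝ f (res x)) :
    db none (fun x => f (res x)) x = 0 := by
  rw [db_comp hf (res_contDiff.differentiable (by simp) x), res_fderiv]
  exact Finset.sum_eq_zero fun l _ => by simp [res, Pi.single_apply]

lemma db_emb {q : (ι → ℂ) → ℂ} (hq : ContDiff ℂ ∞ q) {f : (Option ι → ℂ) → ℂ} {z : ι → ℂ} (i : ι)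
    (hf : DifferentiableAt ℝ f (emb q z)) (h0 : db none f (emb q z) = 0) :
    db i (fun z => f (emb q z)) z = db (some i) f (emb q z) := by
  have hd := (emb_contDiff hq).differentiable (by simp) z
  rw [db_comp hf hd, Fintype.sum_option, h0, mul_zero, zero_add]
  have : ∀ l : ι, fderiv ℂ (emb q) z (Pi.single i 1) (some l) = (Pi.single i 1 : ι → ℂ) l := by
    intro l
    have h1 := (hasFDerivAt_pi'.1 hd.hasFDerivAt (some l)).unique
      (hasFDerivAt_apply (𝕜 := ℂ) (F' := fun _ : ι => ℂ) l z)
    simpa using congrArg (fun T => T (Pi.single i 1)) h1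
  rw [Finset.sum_eq_single i]
  · rw [this]; simp
  · intro l _ hl
    rw [this]; simp [Pi.single_apply, hl]
  · simp

lemma realSmooth {κ : Type} [Fintype κ] {f : (κ → ℂ) → ℂ} {z : κ → ℂ} (h : ContDiffAt ℂ ∞ f z) :
    ContDiffAt ℝ ∞ f z := h.restrict_scalars ℝ

/-- solvability of all `∂̄ᵢ` equations -/
def Solv {κ : Type} [Fintype κ] [DecidableEq κ] (K : Set (κ → ℂ)) : Prop :=
  ∀ (S : Finset κ) (i : κ) (A : (κ → ℂ) → ℂ), i ∉ S → Hol S K A →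
    ∃ B, Hol S K B ∧ ∀ᶠ x in 𝓝ˢ K, db i B x = A x

lemma lift (K0 : Set (ι → ℂ)) (hK0 : IsCompact K0) (q : (ι → ℂ) → ℂ) (hq : ContDiff ℂ ∞ q)
    (r : ℝ) (hr : 0 < r) (HS : Solv {x : Option ι → ℂ | res x ∈ K0 ∧ ‖x none‖ ≤ r})
    (S : Finset ι) (F : (ι → ℂ) → ℂ) (hF : Hol S {z | z ∈ K0 ∧ ‖q z‖ ≤ r} F) :
    ∃ G, Hol (insert none (S.map Function.Embedding.some))
        {x : Option ι → ℂ | res x ∈ K0 ∧ ‖x none‖ ≤ r} G ∧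
      ∀ᶠ z in 𝓝ˢ {z | z ∈ K0 ∧ ‖q z‖ ≤ r}, G (emb q z) = F z := by
  set K' := {x : Option ι → ℂ | res x ∈ K0 ∧ ‖x none‖ ≤ r} with hK'
  have hqc : Continuous q := hq.continuous
  have hresc : Continuous (res : (Option ι → ℂ) → (ι → ℂ)) := res_contDiff.continuous
  rw [Hol, eventually_nhdsSet_iff_exists] at hF
  obtain ⟨U, hUo, hKU, hU⟩ := hF
  obtain ⟨δ, hδ, hδU⟩ : ∃ δ > 0, ∀ z ∈ K0, z ∉ U → r + 2 * δ < ‖q z‖ := by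
    have hc : IsCompact (K0 \ U) := hK0.diff hUo
    rcases (K0 \ U).eq_empty_or_nonempty with he | hne
    · refine ⟨1, one_pos, fun z hz hzU => ?_⟩
      have : z ∈ K0 \ U := ⟨hz, hzU⟩
      rw [he] at this; exact this.elim
    · obtain ⟨z0, hz0, hmin⟩ := hc.exists_isMinOn hne (hqc.norm.continuousOn)
      have h1 : r < ‖q z0‖ := by
        by_contra h
        exact hz0.2 (hKU ⟨hz0.1, not_lt.1 h⟩)
      refine ⟨(‖q z0‖ - r) / 3, by linarith, fun z hz hzU => ?_⟩
      have h2 : ‖q z0‖ ≤ ‖q z‖ := hmin (show z ∈ K0 \ U from ⟨hz, hzU⟩)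
      linarith
  set V : Set (ι → ℂ) := U ∪ {z | r + 2 * δ < ‖q z‖} with hV
  have hVo : IsOpen V := hUo.union (isOpen_lt continuous_const hqc.norm)
  have hKV : K0 ⊆ V := by
    intro z hz
    by_cases h : z ∈ U
    · exact Or.inl h
    · exact Or.inr (hδU z hz h)
  let η : ContDiffBump (0:ℂ) := ⟨r + δ, r + 2 * δ, by linarith, by linarith⟩
  have hη0 : ∀ x : ℂ, r + 2 * δ ≤ ‖x‖ → η x = 0 := fun x hx =>
    η.zero_of_le_dist (by simpa using hx)
  have hη1 : ∀ x : ℂ, ‖x‖ ≤ r + δ → η x = 1 := fun x hx =>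
    η.one_of_mem_closedBall (by simpa using hx)
  have hηs : ContDiff ℝ ∞ (fun x => ((η x : ℝ) : ℂ)) := Complex.ofRealCLM.contDiff.comp η.contDiff
  have hqR : ContDiff ℝ ∞ q := hq.restrict_scalars ℝ
  set H : (ι → ℂ) → ℂ := fun z => (η (q z) : ℂ) * F z with hH
  have hHs : ∀ z ∈ V, ContDiffAt ℝ ∞ H z := by
    rintro z (hz | hz)
    · exact (hηs.comp hqR).contDiffAt.mul (hU z hz).1
    · refine (contDiffAt_const (c := (0:ℂ))).congr_of_eventuallyEq ?_
      filter_upwards [(isOpen_lt continuous_const hqc.norm).mem_nhds hz] with y hy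
      simp [hH, hη0 _ (le_of_lt hy)]
  have hsmall : ∀ z ∈ V, ‖q z‖ < r + δ → z ∈ U ∧ H =ᶠ[𝓝 z] F := by
    rintro z hz hzq
    refine ⟨?_, ?_⟩
    · rcases hz with hz | hz
      · exact hz
      · have : r + 2 * δ < ‖q z‖ := hz
        linarith
    · filter_upwards [(isOpen_lt hqc.norm continuous_const).mem_nhds hzq] with y hy
      simp [hH, hη1 _ (le_of_lt hy)]
  have hdbsmall : ∀ z ∈ V, ‖q z‖ < r + δ → ∀ i ∈ S, db i H z = 0 := by
    intro z hz hzq i hi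
    obtain ⟨h1, h2⟩ := hsmall z hz hzq
    rw [db_congr h2, (hU z h1).2 i hi]
  set V' : Set (Option ι → ℂ) := {x | res x ∈ V ∧ ‖x none‖ < r + δ} with hV'
  have hV'o : IsOpen V' :=
    (hVo.preimage hresc).inter
      (isOpen_lt (f := fun x : Option ι → ℂ => ‖x none‖) (by fun_prop) continuous_const)
  have hV'K : V' ∈ 𝓝ˢ K' := by
    rw [hV'o.mem_nhdsSet]
    rintro x ⟨h1, h2⟩
    exact ⟨hKV h1, by linarith⟩
  set D : (Option ι → ℂ) → ℂ := fun x => x none - q (res x) with hD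
  have hDC : ContDiff ℂ ∞ D := (contDiff_apply ℂ ℂ none).sub (hq.comp res_contDiff)
  set A : ι → (Option ι → ℂ) → ℂ := fun i x => db i H (res x) * (D x)⁻¹ with hA
  have key : ∀ x ∈ V', ∃ Q, ContDiffAt ℝ ∞ Q x ∧ (∀ i ∈ S, A i =ᶠ[𝓝 x] db (some i) Q) ∧
      db none Q =ᶠ[𝓝 x] fun _ => 0 := by
    intro x hx
    by_cases hxq : ‖q (res x)‖ < r + δ
    · refine ⟨fun _ => 0, contDiffAt_const, fun i hi => ?_, ?_⟩
      · filter_upwards [hV'o.mem_nhds hx,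
          (isOpen_lt (hqc.comp hresc).norm continuous_const).mem_nhds hxq] with y hy hyq
        simp only [hA]
        rw [hdbsmall _ hy.1 hyq i hi, db_const, zero_mul]
      · exact Eventually.of_forall fun y => db_const 0 y
    · have hDx : D x ≠ 0 := by
        intro h0
        have h1 : x none = q (res x) := sub_eq_zero.1 h0
        have := hx.2
        rw [h1] at this
        exact hxq this
      have hDe : ∀ᶠ y in 𝓝 x, D y ≠ 0 := hDC.continuous.continuousAt.eventually_ne hDx
      have hE : ∀ y, D y ≠ 0 → ContDiffAt ℂ ∞ (fun y => (D y)⁻¹) y := fun y hy =>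
        hDC.contDiffAt.inv hy
      have hHr : ∀ y ∈ V', ContDiffAt ℝ ∞ (fun y => H (res y)) y := fun y hy =>
        (hHs _ hy.1).comp y (res_contDiff.restrict_scalars ℝ).contDiffAt
      refine ⟨fun y => H (res y) * (D y)⁻¹, (hHr x hx).mul (realSmooth (hE x hDx)), ?_, ?_⟩
      · intro i hi
        filter_upwards [hV'o.mem_nhds hx, hDe] with y hy hDy
        rw [db_mul (diffAt (hHr y hy)) (diffAt (realSmooth (hE y hDy))),
          db_of_hol ((hE y hDy).differentiableAt (by simp)), db_res_some i (diffAt (hHs _ hy.1))]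
        simp only [hA]; ring
      · filter_upwards [hV'o.mem_nhds hx, hDe] with y hy hDy
        rw [db_mul (diffAt (hHr y hy)) (diffAt (realSmooth (hE y hDy))),
          db_of_hol ((hE y hDy).differentiableAt (by simp)), db_res_none (diffAt (hHs _ hy.1))]
        ring
  have sub : ∀ T : Finset ι, T ⊆ S → ∃ B : (Option ι → ℂ) → ℂ, ∀ᶠ x in 𝓝ˢ K',
      ContDiffAt ℝ ∞ B x ∧ db none B x = 0 ∧ ∀ i ∈ T, db (some i) B x = A i x := by
    intro T
    induction T using Finset.induction_on with
    | empty =>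
      intro _
      exact ⟨fun _ => 0, Eventually.of_forall fun x => ⟨contDiffAt_const, db_const 0 x, by simp⟩⟩
    | insert a T haT ih =>
      intro hTS
      have haS : a ∈ S := hTS (Finset.mem_insert_self a T)
      have hTS' : T ⊆ S := fun i hi => hTS (Finset.mem_insert_of_mem hi)
      obtain ⟨B, hB⟩ := ih hTS'
      obtain ⟨B', hB', hdB'⟩ := HS (insert none (T.map Function.Embedding.some)) (some a)
        (fun x => A a x - db (some a) B x) (by simp [haT]) (by
          filter_upwards [hV'K, hB.eventually_nhdsSet] with x hxV hxB
          obtain ⟨Q, hQ, hQA, hQn⟩ := key x hxV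
          have hBx := hxB.self_of_nhds
          have e1 : (fun x => A a x - db (some a) B x) =ᶠ[𝓝 x]
              fun y => db (some a) Q y - db (some a) B y := by
            filter_upwards [hQA a haS] with y hy
            rw [hy]
          refine ⟨((db_contDiffAt hQ).sub (db_contDiffAt hBx.1)).congr_of_eventuallyEq e1, ?_⟩
          intro o ho
          rw [db_congr e1, db_sub (diffAt (db_contDiffAt hQ)) (diffAt (db_contDiffAt hBx.1)),
            db_comm hQ, db_comm hBx.1, sub_eq_zero]
          apply db_congr
          rcases Finset.mem_insert.1 ho with rfl | ho
          · filter_upwards [hQn, hxB] with y hy1 hy2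
            rw [hy1, hy2.2.1]
          · obtain ⟨i, hi, rfl⟩ := Finset.mem_map.1 ho
            filter_upwards [hQA i (hTS' hi), hxB] with y hy1 hy2
            simp only [Function.Embedding.some_apply]
            rw [← hy1, hy2.2.2 i hi])
      refine ⟨fun x => B x + B' x, ?_⟩
      filter_upwards [hB, hB', hdB'] with x h1 h2 h3
      refine ⟨h1.1.add h2.1, ?_, ?_⟩
      · rw [db_add (diffAt h1.1) (diffAt h2.1), h1.2.1, h2.2 none (by simp), add_zero]
      · intro i hi
        rw [db_add (diffAt h1.1) (diffAt h2.1)]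
        rcases Finset.mem_insert.1 hi with rfl | hi
        · rw [h3]; ring
        · rw [h1.2.2 i hi, h2.2 (some i) (by simp [hi]), add_zero]
  obtain ⟨B, hB⟩ := sub S subset_rfl
  refine ⟨fun x => H (res x) - D x * B x, ?_, ?_⟩
  · filter_upwards [hV'K, hB] with x hx hxB
    have hHr : ContDiffAt ℝ ∞ (fun y => H (res y)) x :=
      (hHs _ hx.1).comp x (res_contDiff.restrict_scalars ℝ).contDiffAt
    have hDR : ContDiffAt ℝ ∞ D x := realSmooth hDC.contDiffAt
    have hDB : ContDiffAt ℝ ∞ (fun x => D x * B x) x := hDR.mul hxB.1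
    refine ⟨hHr.sub hDB, ?_⟩
    intro o ho
    rw [db_sub (diffAt hHr) (diffAt hDB), db_mul (diffAt hDR) (diffAt hxB.1),
      db_of_hol (f := D) (hDC.differentiable (by simp) x)]
    rcases Finset.mem_insert.1 ho with rfl | ho
    · rw [db_res_none (diffAt (hHs _ hx.1)), hxB.2.1]; ring
    · obtain ⟨i, hi, rfl⟩ := Finset.mem_map.1 ho
      simp only [Function.Embedding.some_apply]
      rw [db_res_some i (diffAt (hHs _ hx.1)), hxB.2.2 i hi]
      simp only [hA]
      by_cases h0 : D x = 0
      · have h1 : x none = q (res x) := sub_eq_zero.1 h0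
        have h2 := hx.2
        rw [h1] at h2
        rw [hdbsmall _ hx.1 h2 i hi]; simp
      · field_simp; ring
  · have hop : IsOpen {z | ‖q z‖ < r + δ} := isOpen_lt hqc.norm continuous_const
    have : {z | ‖q z‖ < r + δ} ∈ 𝓝ˢ {z | z ∈ K0 ∧ ‖q z‖ ≤ r} := by
      rw [hop.mem_nhdsSet]
      rintro z ⟨-, hz⟩
      simp only [mem_setOf_eq] at hz ⊢
      linarith
    filter_upwards [this] with z hz
    simp [hD, hH, hη1 _ (le_of_lt hz)]

lemma emb_tendsto (K0 : Set (ι → ℂ)) (q : (ι → ℂ) → ℂ) (hq : ContDiff ℂ ∞ q) (r : ℝ) :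
    Tendsto (emb q) (𝓝ˢ {z | z ∈ K0 ∧ ‖q z‖ ≤ r})
      (𝓝ˢ {x : Option ι → ℂ | res x ∈ K0 ∧ ‖x none‖ ≤ r}) :=
  (emb_contDiff hq).continuous.tendsto_nhdsSet (fun z hz => by simpa using hz)

lemma solve_step (K0 : Set (ι → ℂ)) (hK0 : IsCompact K0) (q : (ι → ℂ) → ℂ) (hq : ContDiff ℂ ∞ q)
    (r : ℝ) (hr : 0 < r) (HS : Solv {x : Option ι → ℂ | res x ∈ K0 ∧ ‖x none‖ ≤ r}) :
    Solv {z | z ∈ K0 ∧ ‖q z‖ ≤ r} := by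
  intro S i A hi hA
  obtain ⟨A', hA', hAe⟩ := lift K0 hK0 q hq r hr HS S A hA
  obtain ⟨B', hB', hBe⟩ := HS _ (some i) A' (by simp [hi]) hA'
  have ht := emb_tendsto K0 q hq r
  refine ⟨fun z => B' (emb q z), ?_, ?_⟩
  · filter_upwards [ht.eventually hB'] with z hz
    refine ⟨hz.1.comp z ((emb_contDiff hq).restrict_scalars ℝ).contDiffAt, fun l hl => ?_⟩
    rw [db_emb hq l (diffAt hz.1) (hz.2 none (by simp)), hz.2 (some l) (by simp [hl])]
  · filter_upwards [ht.eventually hB', ht.eventually hBe, hAe] with z hz h1 h2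
    rw [db_emb hq i (diffAt hz.1) (hz.2 none (by simp)), h1, h2]

end lift
end Oka

namespace Oka
open scoped ContDiff Topology Real
open Filter Set

/-- polynomial polyhedron -/
def KP {ι : Type} {k : ℕ} (ρ : ι → ℝ) (p : Fin k → (ι → ℂ) → ℂ) (r : Fin k → ℝ) : Set (ι → ℂ) :=
  {z | (∀ l, ‖z l‖ ≤ ρ l) ∧ ∀ j, ‖p j z‖ ≤ r j}

lemma KP_compact {ι : Type} [Fintype ι] [DecidableEq ι] {k : ℕ} (ρ : ι → ℝ)
    (p : Fin k → (ι → ℂ) → ℂ) (hp : ∀ j, Continuous (p j)) (r : Fin k → ℝ) :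
    IsCompact (KP ρ p r) := by
  have : KP ρ p r = PD ρ ∩ ⋂ j, {z | ‖p j z‖ ≤ r j} := by
    ext z; simp [KP, PD]
  rw [this]
  exact (PD_compact ρ).inter_right
    (isClosed_iInter fun j => isClosed_le (hp j).norm continuous_const)

lemma KP_succ {ι : Type} {k : ℕ} (ρ : ι → ℝ)
    (p : Fin (k + 1) → (ι → ℂ) → ℂ) (r : Fin (k + 1) → ℝ) :
    KP ρ p r = {z | z ∈ KP ρ (fun j => p j.succ) (fun j => r j.succ) ∧ ‖p 0 z‖ ≤ r 0} := by
  ext z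
  simp only [KP, Set.mem_setOf_eq, Fin.forall_fin_succ]
  tauto

lemma KP_option {ι : Type} {k : ℕ} (ρ : ι → ℝ) (s : ℝ)
    (p : Fin k → (ι → ℂ) → ℂ) (r : Fin k → ℝ) :
    {x : Option ι → ℂ | res x ∈ KP ρ p r ∧ ‖x none‖ ≤ s} =
      KP (fun o : Option ι => o.elim s ρ) (fun j x => p j (res x)) r := by
  ext x
  simp only [KP, Set.mem_setOf_eq, Option.forall, Option.elim, res]
  tauto

theorem solv_KP : ∀ (k : ℕ) (ι : Type) [Fintype ι] [DecidableEq ι] (ρ : ι → ℝ)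
    (p : Fin k → (ι → ℂ) → ℂ) (r : Fin k → ℝ), (∀ l, 0 < ρ l) → (∀ j, 0 < r j) →
    (∀ j, ContDiff ℂ ∞ (p j)) → Solv (KP ρ p r) := by
  intro k
  induction k with
  | zero =>
    intro ι _ _ ρ p r hρ _ _
    have : KP ρ p r = PD ρ := by ext z; simp [KP, PD]
    rw [this]
    intro S i A hi hA
    exact solve_base ρ hρ S i hi A hA
  | succ k ih =>
    intro ι _ _ ρ p r hρ hr hp
    rw [KP_succ]
    refine solve_step _ (KP_compact _ _ (fun j => (hp _).continuous) _) _ (hp 0) _ (hr 0) ?_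
    rw [KP_option]
    refine ih (Option ι) _ _ _ ?_ (fun j => hr _) (fun j => (hp _).comp res_contDiff)
    rintro (_ | i)
    · exact hr 0
    · exact hρ i

lemma Hol_comp {ι κ : Type} [Fintype ι] [DecidableEq ι] [Fintype κ] [DecidableEq κ]
    {K : Set (ι → ℂ)} {K' : Set (κ → ℂ)} {f : (κ → ℂ) → ℂ} (hf : Hol Finset.univ K' f)
    {Φ : (ι → ℂ) → (κ → ℂ)} (hΦ : ContDiff ℂ ∞ Φ) (hm : MapsTo Φ K K') :
    Hol Finset.univ K (fun x => f (Φ x)) := by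
  have ht := hΦ.continuous.tendsto_nhdsSet hm
  filter_upwards [ht.eventually hf] with z hz
  refine ⟨hz.1.comp z (hΦ.restrict_scalars ℝ).contDiffAt, fun i _ => ?_⟩
  rw [db_comp (diffAt hz.1) (hΦ.differentiable (by simp) z)]
  exact Finset.sum_eq_zero fun l _ => by rw [hz.2 l (Finset.mem_univ l), mul_zero]

/-- regrouping of the coordinates -/
def regroup {ι : Type} {k : ℕ} (y : ι ⊕ Fin (k + 1) → ℂ) : Option ι ⊕ Fin k → ℂ :=
  Sum.elim (fun o => o.elim (y (Sum.inr 0)) (fun i => y (Sum.inl i))) (fun j => y (Sum.inr j.succ))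

theorem extend : ∀ (k : ℕ) (ι : Type) [Fintype ι] [DecidableEq ι] (ρ : ι → ℝ)
    (p : Fin k → (ι → ℂ) → ℂ) (r : Fin k → ℝ), (∀ l, 0 < ρ l) → (∀ j, 0 < r j) →
    (∀ j, ContDiff ℂ ∞ (p j)) → ∀ F, Hol Finset.univ (KP ρ p r) F →
    ∃ G : (ι ⊕ Fin k → ℂ) → ℂ, Hol Finset.univ (PD (Sum.elim ρ r)) G ∧
      ∀ z ∈ KP ρ p r, G (Sum.elim z (fun j => p j z)) = F z := by
  intro k
  induction k with
  | zero =>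
    intro ι _ _ ρ p r hρ _ _ F hF
    refine ⟨fun y => F (fun i => y (Sum.inl i)), ?_, ?_⟩
    · refine Hol_comp hF (Φ := fun y i => y (Sum.inl i))
        (contDiff_pi.2 fun i => contDiff_apply ℂ ℂ (Sum.inl i)) ?_
      intro y hy
      exact ⟨fun l => hy (Sum.inl l), fun j => j.elim0⟩
    · intro z _
      simp
  | succ k ih =>
    intro ι _ _ ρ p r hρ hr hp F hF
    have hpos : ∀ o : Option ι, 0 < o.elim (r 0) ρ := by
      rintro (_ | i)
      · exact hr 0
      · exact hρ i
    rw [KP_succ] at hF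
    obtain ⟨G1, hG1, hGF⟩ := lift _ (KP_compact _ _ (fun j => (hp j.succ).continuous) _) (p 0) (hp 0) (r 0)
      (hr 0) (by
        rw [KP_option]
        exact solv_KP k (Option ι) _ _ _ hpos (fun j => hr _)
          (fun j => (hp _).comp res_contDiff)) Finset.univ F hF
    rw [KP_option] at hG1
    have hu : (insert none ((Finset.univ : Finset ι).map Function.Embedding.some)) =
        (Finset.univ : Finset (Option ι)) := by
      ext o; cases o <;> simp
    rw [hu] at hG1
    obtain ⟨G, hG, hGe⟩ := ih (Option ι) _ _ _ hpos (fun j => hr _)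
          (fun j => (hp j.succ).comp res_contDiff) G1 hG1
    refine ⟨fun y => G (regroup y), ?_, ?_⟩
    · refine Hol_comp hG (Φ := regroup) ?_ ?_
      · rw [contDiff_pi]
        rintro ((_ | i) | j)
        · exact contDiff_apply ℂ ℂ (Sum.inr 0)
        · exact contDiff_apply ℂ ℂ (Sum.inl i)
        · exact contDiff_apply ℂ ℂ (Sum.inr j.succ)
      · intro y hy
        rintro ((_ | i) | j)
        · exact hy (Sum.inr 0)
        · exact hy (Sum.inl i)
        · exact hy (Sum.inr j.succ)
    · intro z hz
      rw [KP_succ] at hz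
      have h1 := hGF.self_of_nhdsSet z hz
      rw [← h1, ← hGe (emb (p 0) z)]
      · congr 1
      · have h2 := KP_option ρ (r 0) (fun j => p j.succ) (fun j => r j.succ)
        have h3 : emb (p 0) z ∈ {x : Option ι → ℂ |
          res x ∈ KP ρ (fun j => p j.succ) (fun j => r j.succ) ∧ ‖x none‖ ≤ r 0} := hz
        rw [h2] at h3
        exact h3

end Oka

namespace Oka
open scoped ContDiff Topology Real
open Filter Set

section approx
variable {ι : Type} [Fintype ι] [DecidableEq ι]

lemma db_dir {i : ι} {f : (ι → ℂ) → ℂ} {z : ι → ℂ} (h : ContDiffAt ℝ ∞ f z) (v : ι → ℂ) :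
    db i (fun y => fderiv ℝ f y v) z = fderiv ℝ (db i f) z v := by
  have h1 : ContDiffAt ℝ ∞ (fderiv ℝ f) z := h.fderiv_right (by simp)
  have hd : DifferentiableAt ℝ (fderiv ℝ f) z := h1.differentiableAt (by simp)
  have hs : IsSymmSndFDerivAt ℝ f z := h.isSymmSndFDerivAt (by
    simp only [minSmoothness_of_isRCLikeNormedField]; exact WithTop.coe_le_coe.2 le_top)
  have e : ∀ u : ι → ℂ, HasFDerivAt (fun y => fderiv ℝ f y u)
      ((fderiv ℝ (fderiv ℝ f) z).flip u) z := by
    intro u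
    exact hd.hasFDerivAt.clm_apply (hasFDerivAt_const u z) |>.congr_fderiv (by ext; simp)
  have key : fderiv ℝ (db i f) z v =
      fderiv ℝ (fderiv ℝ f) z v (Pi.single i 1) +
        Complex.I * fderiv ℝ (fderiv ℝ f) z v (Pi.single i Complex.I) := by
    have := (e (Pi.single i 1)).add ((e (Pi.single i Complex.I)).const_mul Complex.I)
    have h2 := this.fderiv
    have h3 : db i f = (fun y => fderiv ℝ f y (Pi.single i 1)) +
      (fun y => Complex.I * fderiv ℝ f y (Pi.single i Complex.I)) := by ext; simp [db]
    rw [h3, h2]; simp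
  have hs' : ∀ u v, fderiv ℝ (fderiv ℝ f) z u v = fderiv ℝ (fderiv ℝ f) z v u := fun u v => hs u v
  rw [key, db, (e v).fderiv]
  simp [hs' v]

lemma Hol_dir {K : Set (ι → ℂ)} {G : (ι → ℂ) → ℂ} (hG : Hol Finset.univ K G) (v : ι → ℂ) :
    Hol Finset.univ K (fun z => fderiv ℝ G z v) := by
  filter_upwards [Filter.Eventually.eventually_nhdsSet hG] with z hz
  have h0 := hz.self_of_nhds
  refine ⟨(h0.1.fderiv_right (by simp)).clm_apply contDiffAt_const, fun i hi => ?_⟩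
  rw [db_dir h0.1]
  have : db i G =ᶠ[𝓝 z] fun _ => 0 := by
    filter_upwards [hz] with y hy
    exact hy.2 i hi
  rw [this.fderiv_eq]
  simp

lemma line_deriv {G : (ι → ℂ) → ℂ} {x : ι → ℂ} {t : ℂ} (hG : DifferentiableAt ℂ G (t • x)) :
    HasDerivAt (fun t : ℂ => G (t • x)) (∑ l, x l * fderiv ℝ G (t • x) (Pi.single l 1)) t := by
  have h1 : HasDerivAt (fun t : ℂ => t • x) x t := by
    simpa using (hasDerivAt_id t).smul_const x
  have h2 := hG.hasFDerivAt.comp_hasDerivAt t h1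
  refine h2.congr_deriv ?_
  rw [hG.fderiv_restrictScalars ℝ]
  generalize fderiv ℂ G (t • x) = T
  conv_lhs => rw [← Finset.univ_sum_single x]
  rw [map_sum]
  refine Finset.sum_congr rfl fun l _ => ?_
  have : (Pi.single l (x l) : ι → ℂ) = x l • Pi.single l 1 := by
    rw [← Pi.single_smul]; simp
  rw [this, map_smul]
  simp

lemma Hol_zero_line {G : (ι → ℂ) → ℂ} (hG : Hol Finset.univ {0} G) (x : ι → ℂ) :
    ∀ᶠ t : ℂ in 𝓝 0, DifferentiableAt ℂ G (t • x) := by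
  have hc : Tendsto (fun t : ℂ => t • x) (𝓝 0) (𝓝 0) := by
    have : Continuous fun t : ℂ => t • x := by fun_prop
    simpa using this.tendsto 0
  rw [Hol, nhdsSet_singleton] at hG
  filter_upwards [hc.eventually hG] with t ht
  exact hol_of_db (diffAt ht.1) fun i => ht.2 i (Finset.mem_univ i)

lemma coeff_poly (m : ℕ) : ∀ (G : (ι → ℂ) → ℂ), Hol Finset.univ {0} G →
    ∃ P : MvPolynomial ι ℂ, ∀ x : ι → ℂ,
      MvPolynomial.eval x P = iteratedDeriv m (fun t : ℂ => G (t • x)) 0 := by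
  induction m with
  | zero =>
    intro G _
    exact ⟨MvPolynomial.C (G 0), fun x => by simp⟩
  | succ m ih =>
    intro G hG
    choose P hP using fun l : ι => ih (fun z => fderiv ℝ G z (Pi.single l 1)) (Hol_dir hG _)
    refine ⟨∑ l, MvPolynomial.X l * P l, fun x => ?_⟩
    rw [iteratedDeriv_succ']
    have e : deriv (fun t : ℂ => G (t • x)) =ᶠ[𝓝 0]
        fun t => ∑ l, x l * fderiv ℝ G (t • x) (Pi.single l 1) := by
      filter_upwards [Hol_zero_line hG x] with t ht
      exact (line_deriv ht).deriv
    have hcd : ∀ l, ContDiffAt ℂ m (fun t : ℂ => fderiv ℝ G (t • x) (Pi.single l 1)) 0 := by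
      intro l
      have h1 := Hol_zero_line (Hol_dir hG (Pi.single l 1)) x
      have h2 : AnalyticAt ℂ (fun t : ℂ => fderiv ℝ G (t • x) (Pi.single l 1)) 0 := by
        rw [Complex.analyticAt_iff_eventually_differentiableAt]
        filter_upwards [h1] with t ht
        exact (line_deriv ht).differentiableAt
      exact h2.contDiffAt
    rw [e.iteratedDeriv_eq, iteratedDeriv_fun_sum (fun l _ => contDiffAt_const.mul (hcd l)),
      map_sum]
    refine Finset.sum_congr rfl fun l _ => ?_
    rw [map_mul, MvPolynomial.eval_X, hP l x, iteratedDeriv_const_mul_field]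

theorem poly_approx {ρ : ι → ℝ} (hρ : ∀ l, 0 < ρ l) {G : (ι → ℂ) → ℂ}
    (hG : Hol Finset.univ (PD ρ) G) :
    ∃ P : ℕ → MvPolynomial ι ℂ,
      TendstoUniformlyOn (fun N x => MvPolynomial.eval x (P N)) G atTop (PD ρ) := by
  have hG0 : Hol Finset.univ {0} G := by
    refine Filter.Eventually.filter_mono (nhdsSet_mono ?_) hG
    rintro _ rfl l
    simpa using (hρ l).le
  obtain ⟨δ, hδ, hd⟩ := PD_exists hρ hG
  choose Q hQ using fun m => coeff_poly m G hG0
  obtain ⟨c, hc1, hc⟩ : ∃ c : ℝ, 1 < c ∧ ∀ l, c * ρ l < ρ l + δ := by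
    have h1 : ∀ l, ∀ᶠ c : ℝ in 𝓝[>] 1, c * ρ l < ρ l + δ := by
      intro l
      have : Tendsto (fun c : ℝ => c * ρ l) (𝓝[>] 1) (𝓝 (1 * ρ l)) :=
        ((continuous_mul_const (ρ l)).tendsto 1).mono_left nhdsWithin_le_nhds
      exact this.eventually_lt_const (by linarith)
    obtain ⟨c, h2, h3⟩ := ((eventually_all.2 h1).and self_mem_nhdsWithin).exists
    exact ⟨c, h3, h2⟩
  have hdiff : ∀ z ∈ PD (fun l => c * ρ l), DifferentiableAt ℂ G z := by
    intro z hz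
    have := hd z (fun l => (hz l).trans_lt (hc l))
    exact hol_of_db (diffAt this.1) fun i => this.2 i (Finset.mem_univ i)
  obtain ⟨M, hM⟩ := (PD_compact (fun l => c * ρ l)).exists_bound_of_continuousOn
    (fun z hz => (hdiff z hz).continuousAt.continuousWithinAt)
  have hmem : ∀ x ∈ PD ρ, ∀ t : ℂ, ‖t‖ ≤ c → t • x ∈ PD (fun l => c * ρ l) := by
    intro x hx t ht l
    simp only [Pi.smul_apply, smul_eq_mul, norm_mul]
    exact mul_le_mul ht (hx l) (norm_nonneg _) (by linarith)
  have hsum : Summable fun m : ℕ => M * (c⁻¹) ^ m :=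
    (summable_geometric_of_lt_one (by positivity) (inv_lt_one_of_one_lt₀ hc1)).mul_left M
  have hline : ∀ x ∈ PD ρ, ∀ t : ℂ, ‖t‖ ≤ c → DifferentiableAt ℂ (fun t : ℂ => G (t • x)) t :=
    fun x hx t ht => (line_deriv (hdiff _ (hmem x hx t ht))).differentiableAt
  have hbd : ∀ (m : ℕ) (x : ι → ℂ), x ∈ PD ρ →
      ‖((m.factorial : ℂ)⁻¹) * iteratedDeriv m (fun t : ℂ => G (t • x)) 0‖ ≤ M * (c⁻¹) ^ m := by
    intro m x hx
    have := Complex.norm_iteratedDeriv_le_of_forall_mem_sphere_norm_le (c := 0) (R := c) (C := M)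
      (f := fun t : ℂ => G (t • x)) m (by linarith) ?_ ?_
    · rw [norm_mul, norm_inv, Complex.norm_natCast]
      have hf : (0:ℝ) < m.factorial := by exact_mod_cast m.factorial_pos
      rw [inv_mul_le_iff₀ hf]
      refine this.trans (le_of_eq ?_)
      rw [inv_pow]; ring
    · refine DifferentiableOn.diffContOnCl ?_
      rw [closure_ball _ (by linarith)]
      intro t ht
      exact (hline x hx t (by simpa using ht)).differentiableWithinAt
    · intro t ht
      exact hM _ (hmem x hx t (by simpa using (mem_sphere_zero_iff_norm.1 ht).le))
  have hlim := tendstoUniformlyOn_tsum_nat hsum hbd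
  refine ⟨fun N => ∑ m ∈ Finset.range N, MvPolynomial.C ((m.factorial : ℂ)⁻¹) * Q m, ?_⟩
  refine (hlim.congr (Eventually.of_forall ?_)).congr_right ?_
  · intro N x _
    simp [hQ]
  · intro x hx
    have := Complex.hasSum_taylorSeries_on_ball (c := 0) (r := c.toNNReal) (z := 1)
      (f := fun t : ℂ => G (t • x)) ?_ ?_
    · simpa using this.tsum_eq
    · intro t ht
      refine (hline x hx t ?_).differentiableWithinAt
      have : ‖t‖ < max c 0 := by simpa using ht
      rw [max_eq_left (by linarith)] at this
      exact this.le
    · simp [hc1]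

end approx
end Oka

namespace Oka
open scoped ContDiff Topology Real
open Filter Set

section limits
variable {ι : Type} [Fintype ι] [DecidableEq ι]

/-- derivative of a polynomial function -/
noncomputable def polyD (c : ι → ℂ) : (ι → ℂ) →L[ℂ] ℂ :=
  ∑ l, c l • ContinuousLinearMap.proj (R := ℂ) (φ := fun _ : ι => ℂ) l

lemma poly_hasFDerivAt (P : MvPolynomial ι ℂ) (z : ι → ℂ) :
    HasFDerivAt (fun z => MvPolynomial.eval z P)
      (polyD fun l => MvPolynomial.eval z (MvPolynomial.pderiv l P)) z := by
  induction P using MvPolynomial.induction_on with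
  | C a =>
    simp only [MvPolynomial.eval_C, MvPolynomial.pderiv_C, map_zero]
    exact (hasFDerivAt_const a z).congr_fderiv (ContinuousLinearMap.ext fun v => by simp [polyD])
  | add p q hp hq =>
    simp only [map_add]
    exact (hp.add hq).congr_fderiv (ContinuousLinearMap.ext fun v => by
      simp [polyD, add_mul, Finset.sum_add_distrib])
  | mul_X p i hp =>
    have h1 : HasFDerivAt (fun z : ι → ℂ => z i)
      (ContinuousLinearMap.proj (R := ℂ) (φ := fun _ : ι => ℂ) i) z := hasFDerivAt_apply i z
    simp only [map_mul, MvPolynomial.eval_X]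
    refine (hp.mul h1).congr_fderiv ?_
    ext v
    simp [polyD, MvPolynomial.pderiv_X, Derivation.leibniz, Pi.single_apply, add_mul,
      Finset.sum_add_distrib, Finset.mul_sum, apply_ite]
    refine Finset.sum_congr rfl fun l _ => by ring

lemma poly_pderiv_bound (P : MvPolynomial ι ℂ) (z : ι → ℂ) (l : ι) {d C : ℝ} (hd : 0 < d)
    (h : ∀ y ∈ Metric.closedBall z d, ‖MvPolynomial.eval y P‖ ≤ C) :
    ‖MvPolynomial.eval z (MvPolynomial.pderiv l P)‖ ≤ C / d := by
  have h1 : ∀ t : ℂ, HasDerivAt (fun t : ℂ => z + t • (Pi.single l 1 : ι → ℂ)) (Pi.single l 1) t := by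
    intro t
    simpa using ((hasDerivAt_id t).smul_const (Pi.single l 1 : ι → ℂ)).const_add z
  have h2 : ∀ t : ℂ, HasDerivAt
      (fun t : ℂ => MvPolynomial.eval (z + t • (Pi.single l 1 : ι → ℂ)) P)
      (MvPolynomial.eval (z + t • (Pi.single l 1 : ι → ℂ)) (MvPolynomial.pderiv l P)) t := by
    intro t
    refine ((poly_hasFDerivAt P _).comp_hasDerivAt t (h1 t)).congr_deriv ?_
    simp [polyD, Pi.single_apply]
  have := Complex.norm_deriv_le_of_forall_mem_sphere_norm_le (c := 0) (R := d) (C := C)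
    (f := fun t : ℂ => MvPolynomial.eval (z + t • (Pi.single l 1 : ι → ℂ)) P) hd ?_ ?_
  · rw [(h2 0).deriv] at this
    simpa using this
  · exact Differentiable.diffContOnCl fun t => (h2 t).differentiableAt
  · intro t ht
    apply h
    have ht' : ‖t‖ = d := mem_sphere_zero_iff_norm.1 ht
    simp only [Metric.mem_closedBall, dist_self_add_left, norm_smul, Pi.norm_single, norm_one,
      mul_one, ht', le_refl]

lemma pderiv_cauchy (P : ℕ → MvPolynomial ι ℂ) (z0 : ι → ℂ) {s s' : ℝ} (hs : s' < s)
    (h : UniformCauchySeqOn (fun m z => MvPolynomial.eval z (P m)) atTop (Metric.ball z0 s)) (l : ι) :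
    UniformCauchySeqOn (fun m z => MvPolynomial.eval z (MvPolynomial.pderiv l (P m))) atTop
      (Metric.ball z0 s') := by
  rw [Metric.uniformCauchySeqOn_iff] at h ⊢
  intro e he
  set d := (s - s') / 2 with hd
  have hd0 : 0 < d := by rw [hd]; linarith
  obtain ⟨N, hN⟩ := h (e / 2 * d) (by positivity)
  refine ⟨N, fun m hm m' hm' z hz => ?_⟩
  have := poly_pderiv_bound (P m - P m') z l (d := d) (C := e / 2 * d) hd0 ?_
  · rw [map_sub, map_sub, mul_div_cancel_right₀ _ hd0.ne'] at this
    rw [dist_eq_norm]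
    linarith
  · intro y hy
    have hy' : y ∈ Metric.ball z0 s := by
      rw [Metric.mem_ball] at hz ⊢
      rw [Metric.mem_closedBall] at hy
      have := dist_triangle y z z0
      rw [hd] at hy
      linarith
    have := hN m hm m' hm' y hy'
    rw [dist_eq_norm, ← map_sub] at this
    exact this.le

lemma polyD_bound (c c' : ι → ℂ) {e : ℝ} (h : ∀ l, dist (c l) (c' l) ≤ e) :
    dist (polyD c) (polyD c') ≤ Fintype.card ι * e := by
  rw [dist_eq_norm]
  have : polyD c - polyD c' =
      ∑ l, (c l - c' l) • ContinuousLinearMap.proj (R := ℂ) (φ := fun _ : ι => ℂ) l := by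
    refine ContinuousLinearMap.ext fun v => ?_
    simp [polyD, sub_mul]
  rw [this]
  refine (norm_sum_le _ _).trans ?_
  have h2 : ∀ l ∈ (Finset.univ : Finset ι),
      ‖(c l - c' l) • ContinuousLinearMap.proj (R := ℂ) (φ := fun _ : ι => ℂ) l‖ ≤ e := by
    intro l _
    rw [norm_smul, ← dist_eq_norm]
    have h3 : ‖ContinuousLinearMap.proj (R := ℂ) (φ := fun _ : ι => ℂ) l‖ ≤ 1 :=
      ContinuousLinearMap.opNorm_le_bound _ zero_le_one fun v => by
        simpa using norm_le_pi_norm v l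
    calc _ ≤ dist (c l) (c' l) * 1 := by gcongr
      _ ≤ e := by simpa using h l
  refine (Finset.sum_le_sum h2).trans ?_
  simp

lemma lim_contDiffOn (z0 : ι → ℂ) (n : ℕ) : ∀ (P : ℕ → MvPolynomial ι ℂ) (f : (ι → ℂ) → ℂ)
    (s s' : ℝ), s' < s →
    UniformCauchySeqOn (fun m z => MvPolynomial.eval z (P m)) atTop (Metric.ball z0 s) →
    (∀ z ∈ Metric.ball z0 s, Tendsto (fun m => MvPolynomial.eval z (P m)) atTop (𝓝 (f z))) →
    ContDiffOn ℂ n f (Metric.ball z0 s') := by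
  induction n with
  | zero =>
    intro P f s s' hs hu hl
    have h1 := hu.tendstoUniformlyOn_of_tendsto hl
    have h2 : ContinuousOn f (Metric.ball z0 s) := h1.continuousOn
      (Eventually.of_forall fun m => (MvPolynomial.continuous_eval (P m)).continuousOn).frequently
    exact contDiffOn_zero.2 (h2.mono (Metric.ball_subset_ball hs.le))
  | succ n ih =>
    intro P f s s' hs hu hl
    obtain ⟨s1, h1, h1'⟩ := exists_between hs
    have hcau := fun l => pderiv_cauchy P z0 h1' hu l
    have hex : ∀ l, ∃ g : (ι → ℂ) → ℂ, ∀ z ∈ Metric.ball z0 s1,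
        Tendsto (fun m => MvPolynomial.eval z (MvPolynomial.pderiv l (P m))) atTop (𝓝 (g z)) := by
      intro l
      have : ∀ z, ∃ w, z ∈ Metric.ball z0 s1 →
        Tendsto (fun m => MvPolynomial.eval z (MvPolynomial.pderiv l (P m))) atTop (𝓝 w) := by
        intro z
        by_cases hz : z ∈ Metric.ball z0 s1
        · obtain ⟨w, hw⟩ := cauchySeq_tendsto_of_complete ((hcau l).cauchySeq hz)
          exact ⟨w, fun _ => hw⟩
        · exact ⟨0, fun h => (hz h).elim⟩
      choose g hg using this
      exact ⟨g, hg⟩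
    choose g hg using hex
    have hU : TendstoUniformlyOn
        (fun m z => polyD fun l => MvPolynomial.eval z (MvPolynomial.pderiv l (P m)))
        (fun z => polyD fun l => g l z) atTop (Metric.ball z0 s1) := by
      rw [Metric.tendstoUniformlyOn_iff]
      intro e he
      have h2 : ∀ l, ∀ᶠ m in atTop, ∀ z ∈ Metric.ball z0 s1,
          dist (g l z) (MvPolynomial.eval z (MvPolynomial.pderiv l (P m))) <
            e / (Fintype.card ι + 1) := fun l =>
        Metric.tendstoUniformlyOn_iff.1 ((hcau l).tendstoUniformlyOn_of_tendsto (hg l)) _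
          (by positivity)
      filter_upwards [eventually_all.2 h2] with m hm z hz
      refine (polyD_bound _ _ fun l => (hm l z hz).le).trans_lt ?_
      rw [mul_div_assoc', div_lt_iff₀ (by positivity)]
      nlinarith
    have hder : ∀ z ∈ Metric.ball z0 s1, HasFDerivAt f (polyD fun l => g l z) z := fun z hz =>
      hasFDerivAt_of_tendstoUniformlyOn Metric.isOpen_ball hU
        (fun m z _ => poly_hasFDerivAt (P m) z)
        (fun z hz => hl z (Metric.ball_subset_ball h1'.le hz)) hz
    rw [Nat.cast_add, Nat.cast_one, contDiffOn_succ_iff_fderiv_of_isOpen Metric.isOpen_ball]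
    refine ⟨fun z hz => (hder z (Metric.ball_subset_ball h1.le hz)).differentiableAt.differentiableWithinAt,
      by simp, ?_⟩
    have : ContDiffOn ℂ n (fun z => polyD fun l => g l z) (Metric.ball z0 s') := by
      unfold polyD
      exact ContDiffOn.sum fun l _ =>
        (ih _ (g l) s1 s' h1 (hcau l) (hg l)).smul contDiffOn_const
    exact this.congr fun z hz => (hder z (Metric.ball_subset_ball h1.le hz)).fderiv

theorem lim_smooth {P : ℕ → MvPolynomial ι ℂ} {f : (ι → ℂ) → ℂ} {O : Set (ι → ℂ)} (hO : IsOpen O)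
    (h : TendstoUniformlyOn (fun m z => MvPolynomial.eval z (P m)) f atTop O) {z : ι → ℂ}
    (hz : z ∈ O) : ContDiffAt ℂ ∞ f z := by
  obtain ⟨s, hs, hsO⟩ := Metric.isOpen_iff.1 hO z hz
  rw [contDiffAt_infty]
  intro n
  have h1 := h.mono hsO
  refine (lim_contDiffOn z n P f s (s / 2) (by linarith) h1.uniformCauchySeqOn
    fun y hy => h1.tendsto_at hy).contDiffAt (Metric.ball_mem_nhds z (by linarith))

lemma Hol_of_contDiffAt {K : Set (ι → ℂ)} {F : (ι → ℂ) → ℂ}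
    (h : ∀ᶠ z in 𝓝ˢ K, ContDiffAt ℂ ∞ F z) : Hol Finset.univ K F := by
  filter_upwards [h] with z hz
  exact ⟨realSmooth hz, fun i _ => db_of_hol (hz.differentiableAt (by simp))⟩

end limits
end Oka

namespace Oka
open scoped ContDiff Topology Real
open Filter Set

section final

/-- the graph map -/
noncomputable def gra {n k : ℕ} (p : Fin k → MvPolynomial (Fin n) ℂ) (z : Fin n → ℂ) :
    Fin n ⊕ Fin k → ℂ := Sum.elim z fun j => MvPolynomial.eval z (p j)

lemma eval_gra {n k : ℕ} (p : Fin k → MvPolynomial (Fin n) ℂ) (z : Fin n → ℂ)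
    (Q : MvPolynomial (Fin n ⊕ Fin k) ℂ) :
    MvPolynomial.eval z (MvPolynomial.bind₁ (Sum.elim MvPolynomial.X p) Q) =
      MvPolynomial.eval (gra p z) Q := by
  induction Q using MvPolynomial.induction_on with
  | C a => simp
  | add p q hp hq => simp [hp, hq]
  | mul_X q i hq =>
    rw [map_mul, map_mul, hq, MvPolynomial.bind₁_X_right, map_mul, MvPolynomial.eval_X]
    cases i <;> simp [gra]

lemma bx_graph {n k : ℕ} (p : Fin k → MvPolynomial (Fin n) ℂ) {X : Set (Fin n ⊕ Fin k → ℂ)}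
    (hX : IsCompact X) {f : C(X, ℂ)} (hf : f ∈ BXset X) {O : Set (Fin n → ℂ)} (hO : IsOpen O)
    (hOX : ∀ z ∈ O, gra p z ∈ X) {F : (Fin n → ℂ) → ℂ}
    (hF : ∀ z (h : gra p z ∈ X), F z = f ⟨gra p z, h⟩) {z : Fin n → ℂ} (hz : z ∈ O) :
    ContDiffAt ℂ ∞ F z := by
  haveI : CompactSpace X := isCompact_iff_compactSpace.1 hX
  obtain ⟨u, hu, hlim⟩ := mem_closure_iff_seq_limit.1 hf
  choose Q hQ using hu
  rw [ContinuousMap.tendsto_iff_tendstoUniformly, Metric.tendstoUniformly_iff] at hlim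
  refine lim_smooth (P := fun m => MvPolynomial.bind₁ (Sum.elim MvPolynomial.X p) (Q m)) hO ?_ hz
  rw [Metric.tendstoUniformlyOn_iff]
  intro e he
  filter_upwards [hlim e he] with m hm y hy
  have := hm ⟨gra p y, hOX y hy⟩
  rw [← hQ m] at this
  rw [eval_gra, hF y (hOX y hy)]
  exact this

lemma bx_of_hol {ι : Type} [Fintype ι] [DecidableEq ι] {ρ : ι → ℝ} (hρ : ∀ l, 0 < ρ l)
    {G : (ι → ℂ) → ℂ} (hG : Hol Finset.univ (PD ρ) G) :
    ∃ g ∈ BXset (PD ρ), ∀ x (h : x ∈ PD ρ), g ⟨x, h⟩ = G x := by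
  haveI : CompactSpace (PD ρ) := isCompact_iff_compactSpace.1 (PD_compact ρ)
  have hc : ContinuousOn G (PD ρ) := fun x hx =>
    (hG.self_of_nhdsSet x hx).1.continuousAt.continuousWithinAt
  refine ⟨⟨(PD ρ).restrict G, hc.restrict⟩, ?_, fun x h => rfl⟩
  obtain ⟨P, hP⟩ := poly_approx hρ hG
  rw [Metric.tendstoUniformlyOn_iff] at hP
  refine Metric.mem_closure_iff.2 fun e he => ?_
  obtain ⟨m, hm⟩ := (hP e he).exists
  refine ⟨_, ⟨P m, rfl⟩, ?_⟩
  rw [ContinuousMap.dist_lt_iff he]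
  intro x
  exact hm x x.2

end final
end Oka

open Oka
open scoped ContDiff Topology

/-- **Patching over the Oka variety.** With `W_ε, Z_ε, W′_ε, W″_ε, Z′_ε, Z″_ε` as in
the paper (polydisks of radii `R + ε` and `1 + ε` in `ℂⁿ × ℂᵏ`, the graph variety of
the polynomials `p_j`, and the slices `α ≤ c + ε`, `α ≥ c − ε`): for all
`0 < ε′ < ε`, if `f′ ∈ B(W′_ε)` and `f″ ∈ B(W″_ε)` agree on `Z′_ε ∩ Z″_ε`, then there
is a `g ∈ B(W_{ε′})` with `g = f′` on `Z′_{ε′}` and `g = f″` on `Z″_{ε′}`. -/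
theorem patching_over_oka_variety
    {n k : ℕ} (p : Fin k → MvPolynomial (Fin n) ℂ)
    (R : ℝ) (hR : 0 < R) (α : (Fin n → ℂ) →ₗ[ℝ] ℝ) (c : ℝ)
    (W Z W' W'' Z' Z'' : ℝ → Set ((Fin n ⊕ Fin k) → ℂ))
    (hW : ∀ ε, W ε = {x | (∀ i, ‖x (Sum.inl i)‖ ≤ R + ε) ∧
      ∀ j, ‖x (Sum.inr j)‖ ≤ 1 + ε})
    (hZ : ∀ ε, Z ε = {x | x ∈ W ε ∧
      ∀ j, MvPolynomial.eval (fun i => x (Sum.inl i)) (p j) = x (Sum.inr j)})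
    (hW' : ∀ ε, W' ε = {x | x ∈ W ε ∧ α (fun i => x (Sum.inl i)) ≤ c + ε})
    (hW'' : ∀ ε, W'' ε = {x | x ∈ W ε ∧ c - ε ≤ α (fun i => x (Sum.inl i))})
    (hZ' : ∀ ε, Z' ε = Z ε ∩ W' ε) (hZ'' : ∀ ε, Z'' ε = Z ε ∩ W'' ε)
    (ε' ε : ℝ) (hε' : 0 < ε') (hεε : ε' < ε)
    (f' : C(↥(W' ε), ℂ)) (hf' : f' ∈ BXset (W' ε))
    (f'' : C(↥(W'' ε), ℂ)) (hf'' : f'' ∈ BXset (W'' ε))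
    (hagree : ∀ x, x ∈ Z' ε → x ∈ Z'' ε →
      ∀ (h1 : x ∈ W' ε) (h2 : x ∈ W'' ε), f' ⟨x, h1⟩ = f'' ⟨x, h2⟩) :
    ∃ g ∈ BXset (W ε'),
      (∀ x, x ∈ Z' ε' → ∀ (h1 : x ∈ W ε') (h2 : x ∈ W' ε),
        g ⟨x, h1⟩ = f' ⟨x, h2⟩) ∧
      (∀ x, x ∈ Z'' ε' → ∀ (h1 : x ∈ W ε') (h2 : x ∈ W'' ε),
        g ⟨x, h1⟩ = f'' ⟨x, h2⟩) := by
  classical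
  have hα : Continuous α := α.continuous_of_finiteDimensional
  have hWPD : ∀ e, W e = PD (Sum.elim (fun _ : Fin n => R + e) (fun _ : Fin k => 1 + e)) := by
    intro e
    rw [hW]
    ext x
    simp [PD]
  have hπ : Continuous fun x : Fin n ⊕ Fin k → ℂ => α (fun i => x (Sum.inl i)) :=
    hα.comp (by fun_prop)
  have hcW : IsCompact (W ε) := by rw [hWPD]; exact PD_compact _
  have hcW' : IsCompact (W' ε) := by
    rw [hW']
    exact hcW.inter_right (isClosed_le hπ continuous_const)
  have hcW'' : IsCompact (W'' ε) := by
    rw [hW'']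
    exact hcW.inter_right (isClosed_le continuous_const hπ)
  have hpc : ∀ j, Continuous fun z => MvPolynomial.eval z (p j) := fun j =>
    MvPolynomial.continuous_eval (p j)
  let O : Set (Fin n → ℂ) := {z | (∀ i, ‖z i‖ < R + ε) ∧ ∀ j, ‖MvPolynomial.eval z (p j)‖ < 1 + ε}
  have hOo : IsOpen O := by
    have : O = (⋂ i, {z : Fin n → ℂ | ‖z i‖ < R + ε}) ∩
        ⋂ j, {z : Fin n → ℂ | ‖MvPolynomial.eval z (p j)‖ < 1 + ε} := by
      ext z; simp [O]
    rw [this]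
    exact (isOpen_iInter_of_finite fun i => isOpen_lt (by fun_prop) continuous_const).inter
      (isOpen_iInter_of_finite fun j => isOpen_lt (hpc j).norm continuous_const)
  have hOW : ∀ z ∈ O, gra p z ∈ W ε := by
    intro z hz
    rw [hW]
    exact ⟨fun i => (hz.1 i).le, fun j => (hz.2 j).le⟩
  have hOZ : ∀ z ∈ O, gra p z ∈ Z ε := by
    intro z hz
    rw [hZ]
    exact ⟨hOW z hz, fun j => rfl⟩
  have hm' : ∀ z ∈ O, α z ≤ c + ε → gra p z ∈ W' ε := by
    intro z hz h
    rw [hW']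
    exact ⟨hOW z hz, h⟩
  have hm'' : ∀ z ∈ O, c - ε ≤ α z → gra p z ∈ W'' ε := by
    intro z hz h
    rw [hW'']
    exact ⟨hOW z hz, h⟩
  let F1 : (Fin n → ℂ) → ℂ := fun z => if h : gra p z ∈ W' ε then f' ⟨_, h⟩ else 0
  let F2 : (Fin n → ℂ) → ℂ := fun z => if h : gra p z ∈ W'' ε then f'' ⟨_, h⟩ else 0
  have hF1 : ∀ z (h : gra p z ∈ W' ε), F1 z = f' ⟨gra p z, h⟩ := fun z h => dif_pos h
  have hF2 : ∀ z (h : gra p z ∈ W'' ε), F2 z = f'' ⟨gra p z, h⟩ := fun z h => dif_pos h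
  let F : (Fin n → ℂ) → ℂ := fun z => if α z ≤ c then F1 z else F2 z
  have h12 : ∀ z ∈ O, c - ε ≤ α z → α z ≤ c + ε → F1 z = F2 z := by
    intro z hz h1 h2
    rw [hF1 z (hm' z hz h2), hF2 z (hm'' z hz h1)]
    apply hagree
    · rw [hZ']; exact ⟨hOZ z hz, hm' z hz h2⟩
    · rw [hZ'']; exact ⟨hOZ z hz, hm'' z hz h1⟩
  have hFF1 : ∀ z ∈ O, α z ≤ c + ε → F z = F1 z := by
    intro z hz h
    by_cases hc : α z ≤ c
    · exact if_pos hc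
    · rw [show F z = F2 z from if_neg hc, h12 z hz (by linarith) h]
  have hFF2 : ∀ z ∈ O, c - ε ≤ α z → F z = F2 z := by
    intro z hz h
    by_cases hc : α z ≤ c
    · rw [show F z = F1 z from if_pos hc, h12 z hz h (by linarith)]
    · exact if_neg hc
  have hFs : ∀ z ∈ O, ContDiffAt ℂ ∞ F z := by
    intro z hz
    by_cases hc : α z < c + ε
    · have ho : IsOpen (O ∩ {z | α z < c + ε}) := hOo.inter (isOpen_lt hα continuous_const)
      have hzm : z ∈ O ∩ {z | α z < c + ε} := ⟨hz, hc⟩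
      have h1 : ContDiffAt ℂ ∞ F1 z := bx_graph p hcW' hf' ho
        (fun y hy => hm' y hy.1 (le_of_lt hy.2)) hF1 hzm
      refine h1.congr_of_eventuallyEq ?_
      filter_upwards [ho.mem_nhds hzm] with y hy
      exact hFF1 y hy.1 (le_of_lt hy.2)
    · have ho : IsOpen (O ∩ {z | c - ε < α z}) := hOo.inter (isOpen_lt continuous_const hα)
      have hzm : z ∈ O ∩ {z | c - ε < α z} := ⟨hz, show c - ε < α z by linarith⟩
      have h1 : ContDiffAt ℂ ∞ F2 z := bx_graph p hcW'' hf'' ho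
        (fun y hy => hm'' y hy.1 (le_of_lt hy.2)) hF2 hzm
      refine h1.congr_of_eventuallyEq ?_
      filter_upwards [ho.mem_nhds hzm] with y hy
      exact hFF2 y hy.1 (le_of_lt hy.2)
  have hKO : KP (fun _ : Fin n => R + ε') (fun j z => MvPolynomial.eval z (p j))
      (fun _ : Fin k => 1 + ε') ⊆ O := by
    rintro z ⟨h1, h2⟩
    exact ⟨fun i => (h1 i).trans_lt (by linarith), fun j => (h2 j).trans_lt (by linarith)⟩
  have hHol : Hol Finset.univ (KP (fun _ : Fin n => R + ε') (fun j z => MvPolynomial.eval z (p j))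
      (fun _ : Fin k => 1 + ε')) F := by
    apply Hol_of_contDiffAt
    filter_upwards [hOo.mem_nhdsSet.2 hKO] with z hz
    exact hFs z hz
  have hps : ∀ j, ContDiff ℂ ∞ fun z => MvPolynomial.eval z (p j) := by
    intro j
    rw [contDiff_iff_contDiffAt]
    intro z
    refine lim_smooth (P := fun _ => p j) isOpen_univ ?_ (Set.mem_univ z)
    rw [Metric.tendstoUniformlyOn_iff]
    intro e he
    exact Filter.Eventually.of_forall fun m x _ => by simpa using he
  obtain ⟨G, hG, hGF⟩ := extend k (Fin n) _ _ _ (fun _ => by linarith) (fun _ => by linarith)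
    hps F hHol
  have hρ : ∀ l, 0 < Sum.elim (fun _ : Fin n => R + ε') (fun _ : Fin k => 1 + ε') l := by
    rintro (l | l)
    · simp only [Sum.elim_inl]; linarith
    · simp only [Sum.elim_inr]; linarith
  have hex : ∃ g ∈ BXset (W ε'), ∀ x (h : x ∈ W ε'), g ⟨x, h⟩ = G x := by
    rw [hWPD]
    exact bx_of_hol hρ hG
  obtain ⟨g, hg, hgG⟩ := hex
  have hZx : ∀ x ∈ Z ε', ∃ z, x = gra p z ∧ z ∈ O ∧ G x = F z := by
    intro x hx
    rw [hZ, hW] at hx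
    obtain ⟨⟨h1, h2⟩, h3⟩ := hx
    have hxz : x = gra p (fun i => x (Sum.inl i)) := by
      ext (i | j)
      · rfl
      · exact (h3 j).symm
    have hzK : (fun i => x (Sum.inl i)) ∈ KP (fun _ : Fin n => R + ε')
        (fun j z => MvPolynomial.eval z (p j)) (fun _ : Fin k => 1 + ε') :=
      ⟨h1, fun j => by
        change ‖MvPolynomial.eval (fun i => x (Sum.inl i)) (p j)‖ ≤ _
        rw [h3 j]; exact h2 j⟩
    refine ⟨fun i => x (Sum.inl i), hxz, hKO hzK, ?_⟩
    rw [← hGF _ hzK]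
    exact congrArg G hxz
  refine ⟨g, hg, ?_, ?_⟩
  · intro x hx h1 h2
    rw [hZ'] at hx
    obtain ⟨z, rfl, hzO, hGz⟩ := hZx x hx.1
    have hx2 := h2
    rw [hW'] at hx2
    rw [hgG, hGz, hFF1 z hzO hx2.2, hF1 z h2]
  · intro x hx h1 h2
    rw [hZ''] at hx
    obtain ⟨z, rfl, hzO, hGz⟩ := hZx x hx.1
    have hx2 := h2
    rw [hW''] at hx2
    rw [hgG, hGz, hFF2 z hzO hx2.2, hF2 z h2]
end
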